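/- For every K > 0 there exist constants C₃ > 0 and ρ ∈ (0,1), both depending only on K, with the following property: for every 1-periodic C² function F : ℝ³ → ℝ with ‖F‖_{C²} ≤ K and ∫_{[0,1]³} e^F dV = 1, and every u ∈ C̃⁴(T³) solving the reduced Calabi–Yau equation (u_xx + 1)(u_yy + u_tt + u_t + 1) − u_xy² − u_xt² = e^F, one has ‖u‖_{C^{2+ρ}} ≤ C₃; in particular all derivatives of u up to order 2 are bounded by C₃ in sup norm and all second derivatives of u are ρ-Hölder continuous with Hölder constant at most C₃. -/

import Mathlib

open MeasureTheory

noncomputable section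

/-- Points of `ℝ³`, written as `ℝ × ℝ × ℝ`. -/
abbrev R3 := ℝ × ℝ × ℝ

/-- The coordinate direction `x`. -/
def vx : R3 := (1, 0, 0)
/-- The coordinate direction `y`. -/
def vy : R3 := (0, 1, 0)
/-- The coordinate direction `t`. -/
def vt : R3 := (0, 0, 1)

/-- Partial (directional) derivative in the direction `e`. -/
def pd (e : R3) (u : R3 → ℝ) : R3 → ℝ := fun p => fderiv ℝ u p e

/-- `1`-periodicity in each of the three variables. -/
def Periodic3 (u : R3 → ℝ) : Prop :=
  ∀ p : R3, u (p + vx) = u p ∧ u (p + vy) = u p ∧ u (p + vt) = u p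

/-- The unit cube `[0,1]³`. -/
def cube : Set R3 := Set.Icc (0, 0, 0) (1, 1, 1)

/-- Zero mean over the unit cube. -/
def ZeroMean (u : R3 → ℝ) : Prop := ∫ p in cube, u p = 0

/-- The reduced Calabi–Yau equation
`(u_xx + 1)(u_yy + u_tt + u_t + 1) − u_xy² − u_xt² = e^F` on `ℝ³`. -/
def CYeq (F u : R3 → ℝ) : Prop :=
  ∀ p : R3,
    (pd vx (pd vx u) p + 1)
        * (pd vy (pd vy u) p + pd vt (pd vt u) p + pd vt u p + 1)
      - (pd vy (pd vx u) p) ^ 2 - (pd vt (pd vx u) p) ^ 2 = Real.exp (F p)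

/-- The Euclidean norm on `ℝ³ = ℝ × ℝ × ℝ`. -/
def enorm3 (h : R3) : ℝ := Real.sqrt (h.1 ^ 2 + h.2.1 ^ 2 + h.2.2 ^ 2)

/-- `‖F‖_{C²} ≤ K`: all partial derivatives of `F` of order `≤ 2` are bounded by `K`. -/
def C2Bound (F : R3 → ℝ) (K : ℝ) : Prop :=
  ∀ p : R3, |F p| ≤ K ∧
    (∀ e ∈ ({vx, vy, vt} : Set R3), |pd e F p| ≤ K) ∧
    (∀ e ∈ ({vx, vy, vt} : Set R3), ∀ e' ∈ ({vx, vy, vt} : Set R3),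
      |pd e (pd e' F) p| ≤ K)

section Calculus

variable {e e' : R3} {f g : R3 → ℝ}

theorem pd_apply_add (hf : Differentiable ℝ f) (hg : Differentiable ℝ g) :
    pd e (fun p => f p + g p) = fun p => pd e f p + pd e g p := by
  funext p
  simp only [pd]
  rw [fderiv_fun_add (hf p) (hg p)]
  rfl

theorem pd_apply_sub (hf : Differentiable ℝ f) (hg : Differentiable ℝ g) :
    pd e (fun p => f p - g p) = fun p => pd e f p - pd e g p := by
  funext p
  simp only [pd]
  rw [fderiv_fun_sub (hf p) (hg p)]
  rfl

theorem pd_apply_neg : pd e (fun p => -f p) = fun p => -pd e f p := by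
  funext p
  simp only [pd]
  rw [fderiv_fun_neg]
  rfl

theorem pd_apply_const (c : ℝ) : pd e (fun _ => c) = fun _ => 0 := by
  funext p
  simp [pd]

theorem pd_apply_mul (hf : Differentiable ℝ f) (hg : Differentiable ℝ g) :
    pd e (fun p => f p * g p) = fun p => f p * pd e g p + g p * pd e f p := by
  funext p
  simp only [pd]
  rw [fderiv_fun_mul (hf p) (hg p)]
  rfl

theorem pd_apply_pow (n : ℕ) (hf : Differentiable ℝ f) :
    pd e (fun p => f p ^ n) = fun p => n * f p ^ (n - 1) * pd e f p := by
  funext p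
  simp only [pd]
  rw [fderiv_fun_pow n (hf p)]
  simp

theorem pd_apply_exp (hf : Differentiable ℝ f) :
    pd e (fun p => Real.exp (f p)) = fun p => Real.exp (f p) * pd e f p := by
  funext p
  simp only [pd]
  rw [fderiv_exp (hf p)]
  rfl

theorem pd_apply_inv (hf : Differentiable ℝ f) (h0 : ∀ p, f p ≠ 0) :
    pd e (fun p => (f p)⁻¹) = fun p => -((f p)⁻¹) ^ 2 * pd e f p := by
  funext p
  simp only [pd]
  have h := (hasDerivAt_inv (h0 p)).comp_hasFDerivAt p (hf p).hasFDerivAt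
  have h' : fderiv ℝ (fun p => (f p)⁻¹) p = _ := h.fderiv
  rw [h']
  simp

theorem pd_zero_dir : pd 0 f = fun _ => 0 := by
  funext p
  simp [pd]

theorem pd_add_dir : pd (e + e') f = fun p => pd e f p + pd e' f p := by
  funext p
  simp [pd]

theorem pd_smul_dir (c : ℝ) : pd (c • e) f = fun p => c * pd e f p := by
  funext p
  simp [pd]

theorem pd_comp_add (v : R3) (p : R3) : pd e (fun q => f (q + v)) p = pd e f (p + v) := by
  simp only [pd]
  rw [fderiv_comp_add_right]

theorem contDiff_pd {n : ℕ} (hf : ContDiff ℝ (n + 1) f) : ContDiff ℝ n (pd e f) :=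
  (hf.fderiv_right le_rfl).clm_apply contDiff_const

theorem pd_comm (hf : ContDiff ℝ 2 f) : pd e (pd e' f) = pd e' (pd e f) := by
  have hd : Differentiable ℝ (fderiv ℝ f) :=
    (hf.fderiv_right (m := 1) (by norm_num)).differentiable (by norm_num)
  have key : ∀ a b p, pd a (pd b f) p = fderiv ℝ (fderiv ℝ f) p a b := by
    intro a b p
    have h := (hd p).hasFDerivAt.clm_apply (hasFDerivAt_const b p)
    have h' : fderiv ℝ (pd b f) p = _ := h.fderiv
    change fderiv ℝ (pd b f) p a = _
    rw [h']
    simp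
  funext p
  rw [key, key]
  exact (hf.contDiffAt.isSymmSndFDerivAt (by simp)).eq e e'

theorem hasDerivAt_line (hf : Differentiable ℝ f) (p : R3) (s : ℝ) :
    HasDerivAt (fun s : ℝ => f (p + s • e)) (pd e f (p + s • e)) s := by
  have h1 : HasDerivAt (fun s : ℝ => p + s • e) e s := by
    simpa using ((hasDerivAt_id s).smul_const e).const_add p
  exact (hf (p + s • e)).hasFDerivAt.comp_hasDerivAt s h1

theorem hessian_nonpos_of_max (hf : ContDiff ℝ 2 f) {p : R3} (hp : ∀ q, f q ≤ f p) (ξ : R3) :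
    pd ξ (pd ξ f) p ≤ 0 := by
  by_contra! hpos
  have hd : Differentiable ℝ f := hf.differentiable (by norm_num)
  have hd1 : Differentiable ℝ (pd ξ f) :=
    (contDiff_pd (n := 1) (by exact_mod_cast hf)).differentiable (by norm_num)
  set φ : ℝ → ℝ := fun s => f (p + s • ξ) with hφ
  have h1 : deriv φ = fun s => pd ξ f (p + s • ξ) :=
    funext fun s => (hasDerivAt_line hd p s).deriv
  have h2 : deriv (deriv φ) 0 = pd ξ (pd ξ f) p := by
    rw [h1, (hasDerivAt_line hd1 p 0).deriv]
    simp
  have hmax : IsLocalMax φ 0 := Filter.Eventually.of_forall fun s => by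
    simpa [hφ] using hp (p + s • ξ)
  have hmin : IsLocalMin φ 0 := by
    apply isLocalMin_of_deriv_deriv_pos
    · rw [h2]; exact hpos
    · exact hmax.deriv_eq_zero
    · exact (hasDerivAt_line hd p 0).continuousAt
  have hc : φ =ᶠ[nhds 0] fun _ => φ 0 := by
    filter_upwards [hmax, hmin] with s h h'
    exact le_antisymm h h'
  have h3 : deriv (deriv φ) 0 = 0 := by
    have := hc.deriv.deriv_eq
    simpa using this
  linarith

theorem pd_eq_zero_of_max {p : R3} (hp : ∀ q, f q ≤ f p) (ξ : R3) :
    pd ξ f p = 0 := by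
  have : IsLocalMax f p := Filter.Eventually.of_forall hp
  simp [pd, this.fderiv_eq_zero]

end Calculus

/-- `f` is `n` times continuously differentiable and `1`-periodic. -/
structure CP (n : ℕ) (f : R3 → ℝ) : Prop where
  contDiff : ContDiff ℝ n f
  periodic : Periodic3 f

namespace CP

variable {n m : ℕ} {f g : R3 → ℝ}

theorem mono (hf : CP n f) (h : m ≤ n) : CP m f :=
  ⟨hf.contDiff.of_le (by exact_mod_cast h), hf.periodic⟩

theorem continuous (hf : CP n f) : Continuous f := hf.contDiff.continuous

theorem differentiable (hf : CP (n + 1) f) : Differentiable ℝ f :=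
  hf.contDiff.differentiable (by norm_cast)

theorem const (c : ℝ) : CP n (fun _ => c) := ⟨contDiff_const, fun _ => ⟨rfl, rfl, rfl⟩⟩

theorem neg (hf : CP n f) : CP n (fun p => -f p) :=
  ⟨hf.contDiff.neg, fun p => by simp [hf.periodic p]⟩

theorem add (hf : CP n f) (hg : CP n g) : CP n (fun p => f p + g p) :=
  ⟨hf.contDiff.add hg.contDiff, fun p => by simp [hf.periodic p, hg.periodic p]⟩

theorem sub (hf : CP n f) (hg : CP n g) : CP n (fun p => f p - g p) :=
  ⟨hf.contDiff.sub hg.contDiff, fun p => by simp [hf.periodic p, hg.periodic p]⟩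

theorem mul (hf : CP n f) (hg : CP n g) : CP n (fun p => f p * g p) :=
  ⟨hf.contDiff.mul hg.contDiff, fun p => by simp [hf.periodic p, hg.periodic p]⟩

theorem pow (hf : CP n f) (k : ℕ) : CP n (fun p => f p ^ k) :=
  ⟨hf.contDiff.pow k, fun p => by simp [hf.periodic p]⟩

theorem exp (hf : CP n f) : CP n (fun p => Real.exp (f p)) :=
  ⟨hf.contDiff.exp, fun p => by simp [hf.periodic p]⟩

theorem inv (hf : CP n f) (h0 : ∀ p, f p ≠ 0) : CP n (fun p => (f p)⁻¹) :=
  ⟨hf.contDiff.inv h0, fun p => by simp [hf.periodic p]⟩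

theorem pd (hf : CP (n + 1) f) (e : R3) : CP n (pd e f) := by
  refine ⟨contDiff_pd (by exact_mod_cast hf.contDiff), fun p => ?_⟩
  have h : ∀ v, (∀ q, f (q + v) = f q) → _root_.pd e f (p + v) = _root_.pd e f p := by
    intro v hv
    rw [← pd_comp_add, funext hv]
  exact ⟨h _ fun q => (hf.periodic q).1, h _ fun q => (hf.periodic q).2.1,
    h _ fun q => (hf.periodic q).2.2⟩

theorem comp_add (hf : CP n f) (v : R3) : CP n (fun p => f (p + v)) :=
  ⟨hf.contDiff.comp (contDiff_id.add contDiff_const), fun p => by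
    simp [add_right_comm p _ v, hf.periodic (p + v)]⟩

end CP

section Torus

/-- The circle `ℝ / ℤ` carries its Haar probability measure. -/
local instance unitCircleMeasureSpace : MeasureSpace UnitAddCircle := ⟨AddCircle.haarAddCircle⟩

local instance unitCircleIsAddHaar : Measure.IsAddHaarMeasure (volume : Measure UnitAddCircle) :=
  inferInstanceAs (Measure.IsAddHaarMeasure AddCircle.haarAddCircle)

local instance unitCircleIsProb : IsProbabilityMeasure (volume : Measure UnitAddCircle) :=
  inferInstanceAs (IsProbabilityMeasure AddCircle.haarAddCircle)

/-- The coordinate identification of `ℝ³` with functions on `Fin 3`. -/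
def tripleEquiv : (Fin 3 → ℝ) ≃ᵐ R3 :=
  (MeasurableEquiv.piFinSuccAbove (fun _ => ℝ) 0).trans
    (MeasurableEquiv.prodCongr (MeasurableEquiv.refl ℝ) MeasurableEquiv.finTwoArrow)

theorem tripleEquiv_apply (x : Fin 3 → ℝ) : tripleEquiv x = (x 0, x 1, x 2) := rfl

theorem measurePreserving_tripleEquiv : MeasurePreserving tripleEquiv volume volume :=
  ((MeasurePreserving.id volume).prod (volume_preserving_finTwoArrow ℝ)).comp
    (volume_preserving_piFinSuccAbove (fun _ : Fin 3 => ℝ) 0)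

/-- The covering map from `ℝ³` to the torus. -/
def torusMk (p : R3) : UnitAddTorus (Fin 3) := fun i => ((tripleEquiv.symm p i : ℝ) : UnitAddCircle)

theorem torusMk_tripleEquiv (x : Fin 3 → ℝ) :
    torusMk (tripleEquiv x) = fun i => ((x i : ℝ) : UnitAddCircle) := by
  funext i
  rw [torusMk, MeasurableEquiv.symm_apply_apply]

theorem symm_tripleEquiv_apply (p : R3) : tripleEquiv.symm p = ![p.1, p.2.1, p.2.2] := by
  apply tripleEquiv.injective
  rw [MeasurableEquiv.apply_symm_apply]
  rfl

theorem torusMk_add (p v : R3) : torusMk (p + v) = torusMk p + torusMk v := by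
  funext i
  fin_cases i <;> simp [torusMk, symm_tripleEquiv_apply]

theorem isOpenQuotientMap_torusMk : IsOpenQuotientMap torusMk := by
  have h1 : IsOpenQuotientMap
      (fun (x : Fin 3 → ℝ) (i : Fin 3) => ((x i : ℝ) : UnitAddCircle)) :=
    IsOpenQuotientMap.piMap fun _ => QuotientAddGroup.isOpenQuotientMap_mk
  have h2 : IsOpenQuotientMap (tripleEquiv.symm : R3 → Fin 3 → ℝ) := by
    refine Homeomorph.isOpenQuotientMap (X := R3) ⟨tripleEquiv.symm.toEquiv, ?_, ?_⟩
    · change Continuous fun p : R3 => tripleEquiv.symm p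
      simp_rw [symm_tripleEquiv_apply]
      fun_prop
    · change Continuous fun x : Fin 3 → ℝ => ((x 0, x 1, x 2) : R3)
      fun_prop
  exact h1.comp h2

theorem cube_ae_eq : (tripleEquiv ⁻¹' cube : Set (Fin 3 → ℝ)) =ᵐ[volume]
    {x : Fin 3 → ℝ | ∀ i, x i ∈ Set.Ioc (0 : ℝ) (0 + 1)} := by
  have h1 : (tripleEquiv ⁻¹' cube : Set (Fin 3 → ℝ)) = Set.univ.pi fun _ => Set.Icc (0 : ℝ) 1 := by
    ext x
    simp only [Set.mem_preimage, tripleEquiv_apply, cube, Set.mem_Icc, Prod.mk_le_mk, Set.mem_pi,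
      Set.mem_univ, true_imp_iff, Fin.forall_fin_succ]
    simp
    tauto
  have h2 : {x : Fin 3 → ℝ | ∀ i, x i ∈ Set.Ioc (0 : ℝ) (0 + 1)}
      = Set.univ.pi fun _ => Set.Ioc (0 : ℝ) 1 := by
    ext x
    simp
  rw [h1, h2]
  exact Measure.ae_eq_set_pi fun _ _ => Ioc_ae_eq_Icc.symm

theorem integral_cube_torusMk {E : Type*} [NormedAddCommGroup E] [NormedSpace ℝ E]
    (Q : UnitAddTorus (Fin 3) → E) : ∫ p in cube, Q (torusMk p) = ∫ θ, Q θ := by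
  rw [UnitAddTorus.integral_preimage Q 0]
  have h := measurePreserving_tripleEquiv.setIntegral_preimage_emb
    tripleEquiv.measurableEmbedding (fun p => Q (torusMk p)) cube
  rw [← h]
  simp only [torusMk_tripleEquiv, Pi.zero_apply]
  exact setIntegral_congr_set cube_ae_eq

theorem eq_of_torusMk_eq {f : R3 → ℝ} (hf : Periodic3 f) {p q : R3} (h : torusMk p = torusMk q) :
    f p = f q := by
  have h1 : ∀ i, ∃ n : ℤ, tripleEquiv.symm p i = tripleEquiv.symm q i + n := by
    intro i
    have h2 := congrFun h i
    simp only [torusMk] at h2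
    rw [← sub_eq_zero, ← AddCircle.coe_sub, AddCircle.coe_eq_zero_iff] at h2
    obtain ⟨n, hn⟩ := h2
    exact ⟨n, by simp at hn; linarith⟩
  obtain ⟨a, ha⟩ := h1 0
  obtain ⟨b, hb⟩ := h1 1
  obtain ⟨c, hc⟩ := h1 2
  simp only [symm_tripleEquiv_apply, Matrix.cons_val] at ha hb hc
  have hp : p = q + a • vx + b • vy + c • vt := by
    ext <;> simp [vx, vy, vt, ha, hb, hc]
  have hx : Function.Periodic f vx := fun p => (hf p).1
  have hy : Function.Periodic f vy := fun p => (hf p).2.1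
  have ht : Function.Periodic f vt := fun p => (hf p).2.2
  rw [hp, ht.zsmul c, hy.zsmul b, hx.zsmul a]

/-- The function on the torus induced by a continuous periodic function. -/
theorem exists_torus_lift {f : R3 → ℝ} (hf : CP 0 f) :
    ∃ Q : C(UnitAddTorus (Fin 3), ℝ), ∀ p, Q (torusMk p) = f p := by
  obtain ⟨r, hr⟩ := isOpenQuotientMap_torusMk.surjective.hasRightInverse
  have h : ∀ p, f (r (torusMk p)) = f p := fun p => eq_of_torusMk_eq hf.periodic (hr _)
  refine ⟨⟨fun θ => f (r θ), ?_⟩, h⟩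
  rw [isOpenQuotientMap_torusMk.isQuotientMap.continuous_iff]
  exact hf.continuous.congr fun p => (h p).symm

theorem isCompact_cube : IsCompact cube := isCompact_Icc

theorem CP.integrableOn {f : R3 → ℝ} (hf : CP 0 f) : IntegrableOn f cube :=
  hf.continuous.continuousOn.integrableOn_compact isCompact_cube

theorem volume_cube : volume cube = 1 := by
  rw [← measurePreserving_tripleEquiv.measure_preimage_equiv, measure_congr cube_ae_eq]
  have h2 : {x : Fin 3 → ℝ | ∀ i, x i ∈ Set.Ioc (0 : ℝ) (0 + 1)}
      = Set.univ.pi fun _ => Set.Ioc (0 : ℝ) 1 := by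
    ext x
    simp
  rw [h2, volume_pi_pi]
  simp

theorem CP.integral_comp_add {f : R3 → ℝ} (hf : CP 0 f) (v : R3) :
    ∫ p in cube, f (p + v) = ∫ p in cube, f p := by
  obtain ⟨Q, hQ⟩ := exists_torus_lift hf
  simp only [← hQ, torusMk_add]
  rw [integral_cube_torusMk (fun θ => Q (θ + torusMk v)), integral_cube_torusMk]
  exact integral_add_right_eq_self (μ := (volume : Measure (UnitAddTorus (Fin 3)))) (fun θ => Q θ) _

/-- The phase `2π k · p`. -/
def phase (k : Fin 3 → ℤ) (p : R3) : ℝ :=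
  2 * Real.pi * (k 0 * p.1 + k 1 * p.2.1 + k 2 * p.2.2)

theorem mFourier_torusMk (k : Fin 3 → ℤ) (p : R3) :
    UnitAddTorus.mFourier k (torusMk p) = Complex.exp (phase k p * Complex.I) := by
  simp only [UnitAddTorus.mFourier, ContinuousMap.coe_mk, torusMk, Fin.prod_univ_three,
    fourier_coe_apply, symm_tripleEquiv_apply, Matrix.cons_val, ← Complex.exp_add, phase]
  congr 1
  push_cast
  ring

/-- The Fourier coefficients of a periodic function. -/
def fc (f : R3 → ℝ) (k : Fin 3 → ℤ) : ℂ :=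
  ((∫ p in cube, f p * Real.cos (phase k p) : ℝ) : ℂ)
    - ((∫ p in cube, f p * Real.sin (phase k p) : ℝ) : ℂ) * Complex.I

theorem continuous_phase (k : Fin 3 → ℤ) : Continuous (phase k) := by
  unfold phase
  fun_prop

theorem mFourierCoeff_lift {f : R3 → ℝ} (hf : Continuous f)
    {Q : UnitAddTorus (Fin 3) → ℂ} (hQ : ∀ p, Q (torusMk p) = f p) (k : Fin 3 → ℤ) :
    UnitAddTorus.mFourierCoeff Q k = fc f k := by
  rw [UnitAddTorus.mFourierCoeff, ← integral_cube_torusMk]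
  have h : ∀ p, UnitAddTorus.mFourier (-k) (torusMk p) • Q (torusMk p)
      = ((f p * Real.cos (phase k p) : ℝ) : ℂ)
        - ((f p * Real.sin (phase k p) : ℝ) : ℂ) * Complex.I := by
    intro p
    rw [mFourier_torusMk, hQ]
    have : phase (-k) p = -phase k p := by
      simp [phase]
      ring
    rw [this, Complex.exp_mul_I, ← Complex.ofReal_cos, ← Complex.ofReal_sin, Real.cos_neg,
      Real.sin_neg, smul_eq_mul]
    push_cast
    ring
  simp_rw [h]
  have hk := continuous_phase k
  have hi : ∀ g : R3 → ℝ, Continuous g → IntegrableOn (fun p => ((g p : ℝ) : ℂ)) cube :=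
    fun g hg => (Complex.continuous_ofReal.comp hg).continuousOn.integrableOn_compact isCompact_cube
  rw [integral_sub, integral_mul_const, integral_complex_ofReal, integral_complex_ofReal, fc]
  · exact hi _ (by fun_prop)
  · exact (hi (fun p => f p * Real.sin (phase k p)) (by fun_prop)).mul_const _

theorem fourier_expansion {f : R3 → ℝ} (hf : CP 0 f) (hs : Summable fun k => ‖fc f k‖) (p : R3) :
    HasSum (fun k => fc f k * Complex.exp (phase k p * Complex.I)) (f p : ℂ) := by
  obtain ⟨Q, hQ⟩ := exists_torus_lift hf
  let Q' : C(UnitAddTorus (Fin 3), ℂ) := ⟨fun θ => (Q θ : ℂ), by fun_prop⟩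
  have hQ' : ∀ p, Q' (torusMk p) = f p := fun p => by simp [Q', hQ]
  have hc := mFourierCoeff_lift hf.continuous hQ'
  have h := UnitAddTorus.hasSum_mFourier_series_apply_of_summable (f := Q')
    (by rw [funext hc]; exact hs.of_norm) (torusMk p)
  simpa [hc, mFourier_torusMk, hQ'] using h

theorem parseval {f : R3 → ℝ} (hf : CP 0 f) :
    HasSum (fun k => ‖fc f k‖ ^ 2) (∫ p in cube, f p ^ 2) := by
  obtain ⟨Q, hQ⟩ := exists_torus_lift hf
  let Q' : C(UnitAddTorus (Fin 3), ℂ) := ⟨fun θ => (Q θ : ℂ), by fun_prop⟩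
  have hQ' : ∀ p, Q' (torusMk p) = f p := fun p => by simp [Q', hQ]
  have hc := mFourierCoeff_lift hf.continuous hQ'
  have h := UnitAddTorus.hasSum_sq_mFourierCoeff (ContinuousMap.toLp 2 volume ℂ Q')
  simp only [UnitAddTorus.mFourierCoeff_toLp, hc] at h
  convert h using 1
  have h2 : ∫ t, ‖(ContinuousMap.toLp 2 volume ℂ Q') t‖ ^ 2 = ∫ t, ‖Q' t‖ ^ 2 := by
    apply integral_congr_ae
    filter_upwards [ContinuousMap.coeFn_toLp (p := 2) (𝕜 := ℂ) volume Q'] with t ht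
    rw [ht]
  rw [h2, ← integral_cube_torusMk]
  simp [hQ']

end Torus

section Integration

variable {f g : R3 → ℝ}

theorem CP.exists_max (hf : CP 0 f) : ∃ p, ∀ q, f q ≤ f p := by
  obtain ⟨Q, hQ⟩ := exists_torus_lift hf
  obtain ⟨θ, -, hθ⟩ := isCompact_univ.exists_isMaxOn Set.univ_nonempty Q.continuous.continuousOn
  obtain ⟨p, rfl⟩ := isOpenQuotientMap_torusMk.surjective θ
  refine ⟨p, fun q => ?_⟩
  simpa [hQ] using hθ (Set.mem_univ (torusMk q))

theorem CP.exists_bound (hf : CP 0 f) : ∃ M, ∀ p, |f p| ≤ M := by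
  obtain ⟨Q, hQ⟩ := exists_torus_lift hf
  exact ⟨‖Q‖, fun p => by simpa [hQ] using Q.norm_coe_le_norm (torusMk p)⟩

theorem hasDerivAt_integral_comp_add (hf : CP 1 f) (hg : CP 0 g) (e : R3) :
    HasDerivAt (fun s : ℝ => ∫ p in cube, f (p + s • e) * g p)
      (∫ p in cube, pd e f p * g p) 0 := by
  have hf0 : CP 0 f := hf.mono (by norm_num)
  have hd : CP 0 (pd e f) := CP.pd (n := 0) hf e
  obtain ⟨M, hM⟩ := (hd.mul (CP.const 1)).exists_bound
  obtain ⟨N, hN⟩ := hg.exists_bound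
  have h := hasDerivAt_integral_of_dominated_loc_of_deriv_le (μ := volume.restrict cube)
    (F := fun s p => f (p + s • e) * g p) (F' := fun s p => pd e f (p + s • e) * g p)
    (x₀ := (0 : ℝ)) (s := Set.univ) (bound := fun _ => M * N) Filter.univ_mem
    (Filter.Eventually.of_forall fun s =>
      (((hf0.comp_add _).mul hg).continuous).aestronglyMeasurable)
    (((hf0.comp_add _).mul hg).integrableOn)
    (((hd.comp_add _).mul hg).continuous).aestronglyMeasurable
    (Filter.Eventually.of_forall fun p s _ => by
      rw [norm_mul]
      have h1 := hM (p + s • e)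
      rw [mul_one] at h1
      exact mul_le_mul h1 (hN p) (norm_nonneg _) ((abs_nonneg _).trans h1))
    ((CP.const (n := 0) (M * N)).integrableOn)
    (Filter.Eventually.of_forall fun p s _ =>
      (hasDerivAt_line (hf.differentiable (n := 0)) p s).mul_const _)
  simpa using h.2

theorem integral_pd (hf : CP 1 f) (e : R3) : ∫ p in cube, pd e f p = 0 := by
  have h := hasDerivAt_integral_comp_add hf (CP.const 1) e
  have h2 : (fun s : ℝ => ∫ p in cube, f (p + s • e) * 1) = fun _ => ∫ p in cube, f p := by
    funext s
    simpa using (hf.mono (m := 0) (by norm_num)).integral_comp_add (s • e)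
  rw [h2] at h
  simpa using h.unique (hasDerivAt_const _ _)

theorem integral_pd_mul (hf : CP 1 f) (hg : CP 1 g) (e : R3) :
    ∫ p in cube, pd e f p * g p = -∫ p in cube, f p * pd e g p := by
  have h := integral_pd (hf.mul hg) e
  rw [pd_apply_mul (hf.differentiable (n := 0)) (hg.differentiable (n := 0)), integral_add] at h
  · simp_rw [mul_comm (g _)] at h
    linarith
  · exact ((hf.mono (by norm_num)).mul (CP.pd (n := 0) hg e)).integrableOn
  · exact ((hg.mono (by norm_num)).mul (CP.pd (n := 0) hf e)).integrableOn

theorem integral_pd_mul_pd_comm (hf : CP 1 f) (hg : CP 1 g) (e e' : R3) :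
    ∫ p in cube, pd e f p * pd e' g p = ∫ p in cube, pd e' f p * pd e g p := by
  have hf' : CP 0 (pd e f) := CP.pd (n := 0) hf e
  have hg' : CP 0 (pd e g) := CP.pd (n := 0) hg e
  have h1 := hasDerivAt_integral_comp_add hg hf' e'
  have h2 := (hasDerivAt_integral_comp_add hf hg' (-e')).neg
  have h3 : (fun s : ℝ => ∫ p in cube, g (p + s • e') * pd e f p)
      = -fun s : ℝ => ∫ p in cube, f (p + s • -e') * pd e g p := by
    funext s
    have h4 := integral_pd_mul hf (hg.comp_add (s • e')) e
    have h5 := (((hf.mono (by norm_num)).comp_add (s • -e')).mul hg').integral_comp_add (s • e')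
    simp only [Pi.neg_apply]
    simp_rw [mul_comm (g _)]
    rw [h4, ← h5]
    congr 2
    funext p
    rw [pd_comp_add]
    simp [add_assoc]
  rw [h3] at h1
  have h6 := h1.unique h2
  have h7 : pd (-e') f = fun p => -pd e' f p := by
    funext p
    simp [pd]
  rw [h7] at h6
  simp only [neg_mul, integral_neg, neg_neg] at h6
  simp_rw [mul_comm (pd e f _)]
  exact h6

theorem phase_add (k : Fin 3 → ℤ) (p q : R3) : phase k (p + q) = phase k p + phase k q := by
  simp [phase]
  ring

theorem contDiff_phase (k : Fin 3 → ℤ) {n : ℕ} : ContDiff ℝ n (phase k) := by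
  unfold phase
  fun_prop

theorem pd_phase (k : Fin 3 → ℤ) (e p : R3) : pd e (phase k) p = phase k e := by
  have hd : Differentiable ℝ (phase k) := (contDiff_phase k (n := 1)).differentiable (by norm_num)
  have h := hasDerivAt_line (e := e) hd p 0
  have h2 : (fun s : ℝ => phase k (p + s • e)) = fun s => phase k p + s * phase k e := by
    funext s
    rw [phase_add]
    simp [phase]
    ring
  rw [h2] at h
  have h3 : HasDerivAt (fun s : ℝ => phase k p + s * phase k e) (phase k e) 0 := by
    simpa using ((hasDerivAt_id (0 : ℝ)).mul_const (phase k e)).const_add (phase k p)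
  simpa using h.unique h3

theorem phase_vx (k : Fin 3 → ℤ) : phase k vx = 2 * Real.pi * k 0 := by simp [phase, vx]
theorem phase_vy (k : Fin 3 → ℤ) : phase k vy = 2 * Real.pi * k 1 := by simp [phase, vy]
theorem phase_vt (k : Fin 3 → ℤ) : phase k vt = 2 * Real.pi * k 2 := by simp [phase, vt]

theorem cp_cos_phase (k : Fin 3 → ℤ) {n : ℕ} : CP n fun p => Real.cos (phase k p) := by
  refine ⟨Real.contDiff_cos.comp (contDiff_phase k), fun p => ?_⟩
  simp only [phase_add, phase_vx, phase_vy, phase_vt]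
  simp only [mul_comm (2 * Real.pi), Real.cos_add_int_mul_two_pi, and_self]

theorem cp_sin_phase (k : Fin 3 → ℤ) {n : ℕ} : CP n fun p => Real.sin (phase k p) := by
  refine ⟨Real.contDiff_sin.comp (contDiff_phase k), fun p => ?_⟩
  simp only [phase_add, phase_vx, phase_vy, phase_vt]
  simp only [mul_comm (2 * Real.pi), Real.sin_add_int_mul_two_pi, and_self]

theorem pd_cos_phase (k : Fin 3 → ℤ) (e : R3) :
    pd e (fun p => Real.cos (phase k p)) = fun p => -(phase k e) * Real.sin (phase k p) := by
  funext p
  have hd : Differentiable ℝ (phase k) := (contDiff_phase k (n := 1)).differentiable (by norm_num)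
  rw [← pd_phase k e p, pd, fderiv_cos (hd p)]
  simp [pd]
  ring

theorem pd_sin_phase (k : Fin 3 → ℤ) (e : R3) :
    pd e (fun p => Real.sin (phase k p)) = fun p => phase k e * Real.cos (phase k p) := by
  funext p
  have hd : Differentiable ℝ (phase k) := (contDiff_phase k (n := 1)).differentiable (by norm_num)
  rw [← pd_phase k e p, pd, fderiv_sin (hd p)]
  simp [pd]
  ring

theorem fc_pd (hf : CP 1 f) (e : R3) (k : Fin 3 → ℤ) :
    fc (pd e f) k = phase k e * Complex.I * fc f k := by
  have h1 := integral_pd_mul hf (cp_cos_phase k) e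
  have h2 := integral_pd_mul hf (cp_sin_phase k) e
  rw [pd_cos_phase] at h1
  rw [pd_sin_phase] at h2
  simp_rw [mul_left_comm (f _), integral_const_mul] at h1 h2
  rw [fc, fc, h1, h2]
  push_cast
  linear_combination (phase k e * ∫ p in cube, f p * Real.sin (phase k p) : ℂ) * (Complex.I_sq)

theorem fc_add (hf : CP 0 f) (hg : CP 0 g) (k : Fin 3 → ℤ) :
    fc (fun p => f p + g p) k = fc f k + fc g k := by
  simp only [fc, add_mul]
  rw [integral_add (hf.mul (cp_cos_phase k)).integrableOn (hg.mul (cp_cos_phase k)).integrableOn,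
    integral_add (hf.mul (cp_sin_phase k)).integrableOn (hg.mul (cp_sin_phase k)).integrableOn]
  push_cast
  ring

theorem fc_zero : fc f 0 = ((∫ p in cube, f p : ℝ) : ℂ) := by
  have : ∀ p, phase 0 p = 0 := fun p => by simp [phase]
  simp [fc, this]

theorem fc_const {c : ℝ} {k : Fin 3 → ℤ} (hk : k ≠ 0) : fc (fun _ => c) k = 0 := by
  obtain ⟨e, he⟩ : ∃ e, phase k e ≠ 0 := by
    obtain ⟨i, hi⟩ := Function.ne_iff.mp hk
    have hi' : (k i : ℝ) ≠ 0 := by exact_mod_cast hi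
    fin_cases i
    · exact ⟨vx, by rw [phase_vx]; exact mul_ne_zero Real.two_pi_pos.ne' hi'⟩
    · exact ⟨vy, by rw [phase_vy]; exact mul_ne_zero Real.two_pi_pos.ne' hi'⟩
    · exact ⟨vt, by rw [phase_vt]; exact mul_ne_zero Real.two_pi_pos.ne' hi'⟩
  have h := fc_pd (CP.const (n := 1) c) e k
  rw [pd_apply_const] at h
  have h0 : fc (fun _ => 0) k = 0 := by simp [fc]
  rw [h0] at h
  simpa [he] using h.symm

end Integration

section HolderFromFourier

/-- The supremum norm of a lattice point. -/
def latNorm (k : Fin 3 → ℤ) : ℝ := ‖fun i => (k i : ℝ)‖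

theorem one_le_latNorm {k : Fin 3 → ℤ} (hk : k ≠ 0) : 1 ≤ latNorm k := by
  obtain ⟨i, hi⟩ := Function.ne_iff.mp hk
  have h1 : (1 : ℝ) ≤ |(k i : ℝ)| := by exact_mod_cast Int.one_le_abs hi
  exact h1.trans (norm_le_pi_norm (fun i => (k i : ℝ)) i)

theorem latNorm_sq_le (k : Fin 3 → ℤ) : latNorm k ^ 2 ≤ ∑ i, (k i : ℝ) ^ 2 := by
  have h : latNorm k ≤ Real.sqrt (∑ i, (k i : ℝ) ^ 2) := by
    refine (pi_norm_le_iff_of_nonneg (Real.sqrt_nonneg _)).mpr fun i => ?_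
    exact Real.abs_le_sqrt (Finset.single_le_sum (f := fun i => (k i : ℝ) ^ 2)
      (fun j _ => sq_nonneg _) (Finset.mem_univ i))
  calc latNorm k ^ 2 ≤ Real.sqrt (∑ i, (k i : ℝ) ^ 2) ^ 2 :=
        pow_le_pow_left₀ (norm_nonneg _) h 2
    _ = _ := Real.sq_sqrt (Finset.sum_nonneg fun i _ => sq_nonneg _)

theorem intCast_mem_span (k : Fin 3 → ℤ) :
    (fun i => (k i : ℝ)) ∈ Submodule.span ℤ (Set.range (Pi.basisFun ℝ (Fin 3))) := by
  have : (fun i => (k i : ℝ)) = ∑ i, k i • Pi.basisFun ℝ (Fin 3) i := by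
    funext j
    simp [Pi.basisFun_apply, Finset.sum_apply, Pi.single_apply]
  rw [this]
  exact Submodule.sum_mem _ fun i _ =>
    Submodule.smul_mem _ _ (Submodule.subset_span (Set.mem_range_self i))

theorem summable_norm_rpow_comp (L : Submodule ℤ (Fin 3 → ℝ)) [DiscreteTopology L]
    (hrank : Module.finrank ℤ L = 3) (hmem : ∀ k : Fin 3 → ℤ, (fun i => (k i : ℝ)) ∈ L) :
    Summable fun k => latNorm k ^ (-(7 / 2) : ℝ) := by
  have h := ZLattice.summable_norm_rpow L (-(7 / 2)) (by rw [hrank]; norm_num)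
  have hinj : Function.Injective fun k : Fin 3 → ℤ => (⟨fun i => (k i : ℝ), hmem k⟩ : L) := by
    intro k l hkl
    funext i
    have h1 := congrFun (Subtype.ext_iff.mp hkl) i
    dsimp only at h1
    exact_mod_cast h1
  exact (h.comp_injective hinj).congr fun k => rfl

theorem summable_latNorm : Summable fun k => latNorm k ^ (-(7 / 2) : ℝ) := by
  refine summable_norm_rpow_comp (Submodule.span ℤ (Set.range (Pi.basisFun ℝ (Fin 3)))) ?_
    intCast_mem_span
  rw [ZLattice.rank ℝ]
  simp

theorem abs_phase_le (k : Fin 3 → ℤ) (h : R3) : |phase k h| ≤ 20 * (latNorm k * enorm3 h) := by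
  have hk : ∀ i, |(k i : ℝ)| ≤ latNorm k := fun i => norm_le_pi_norm (fun i => (k i : ℝ)) i
  have hx : |h.1| ≤ enorm3 h := Real.abs_le_sqrt (by nlinarith [sq_nonneg h.2.1, sq_nonneg h.2.2])
  have hy : |h.2.1| ≤ enorm3 h := Real.abs_le_sqrt (by nlinarith [sq_nonneg h.1, sq_nonneg h.2.2])
  have ht : |h.2.2| ≤ enorm3 h := Real.abs_le_sqrt (by nlinarith [sq_nonneg h.1, sq_nonneg h.2.1])
  have hm : ∀ i (s : ℝ), |s| ≤ enorm3 h → |(k i : ℝ) * s| ≤ latNorm k * enorm3 h := by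
    intro i s hs
    rw [abs_mul]
    exact mul_le_mul (hk i) hs (abs_nonneg _) (norm_nonneg _)
  have h3 : |k 0 * h.1 + k 1 * h.2.1 + k 2 * h.2.2| ≤ 3 * (latNorm k * enorm3 h) := by
    refine (abs_add_three _ _ _).trans ?_
    linarith [hm 0 _ hx, hm 1 _ hy, hm 2 _ ht]
  rw [phase, abs_mul, abs_of_pos Real.two_pi_pos]
  have hn : 0 ≤ latNorm k * enorm3 h := mul_nonneg (norm_nonneg _) (Real.sqrt_nonneg _)
  nlinarith [Real.pi_lt_d2, Real.pi_pos, abs_nonneg (k 0 * h.1 + k 1 * h.2.1 + k 2 * h.2.2)]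

theorem norm_exp_sub_one_le (θ : ℝ) :
    ‖Complex.exp (θ * Complex.I) - 1‖ ≤ 2 * |θ| ^ (1 / 4 : ℝ) := by
  rcases le_total |θ| 1 with h | h
  · have h1 : ‖Complex.exp (θ * Complex.I) - 1‖ ≤ |θ| := by
      rw [mul_comm]
      exact Real.norm_exp_I_mul_ofReal_sub_one_le
    have h2 : |θ| ^ (1 : ℝ) ≤ |θ| ^ (1 / 4 : ℝ) :=
      Real.rpow_le_rpow_of_exponent_ge' (abs_nonneg _) h (by norm_num) (by norm_num)
    rw [Real.rpow_one] at h2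
    linarith [Real.rpow_nonneg (abs_nonneg θ) (1 / 4)]
  · have h1 : ‖Complex.exp (θ * Complex.I) - 1‖ ≤ 2 := by
      refine (norm_sub_le _ _).trans ?_
      rw [Complex.norm_exp_ofReal_mul_I]
      norm_num
    have h2 := Real.one_le_rpow h (z := (1 / 4 : ℝ)) (by norm_num)
    linarith

theorem exists_holder_const : ∃ C : ℝ, 0 < C ∧ ∀ q g : R3 → ℝ, CP 0 q → CP 0 g → fc q 0 = 0 →
    (∀ k, (∑ i, (k i : ℝ) ^ 2) * ‖fc q k‖ ≤ ‖fc g k‖) →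
    (∀ p, |q p| ≤ C * (1 + ∫ p in cube, g p ^ 2)) ∧
    ∀ p h, |q (p + h) - q p| ≤ C * (1 + ∫ p in cube, g p ^ 2) * enorm3 h ^ (1 / 4 : ℝ) := by
  have hS := summable_latNorm
  set S := ∑' k, latNorm k ^ (-(7 / 2) : ℝ)
  have hS0 : 0 ≤ S := tsum_nonneg fun k => Real.rpow_nonneg (norm_nonneg _) _
  refine ⟨40 * (1 + S), by positivity, fun q g hq hg hq0 hk => ?_⟩
  have hP := parseval hg
  set I := ∫ p in cube, g p ^ 2
  have hI0 : 0 ≤ I := integral_nonneg fun p => sq_nonneg _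
  set T : (Fin 3 → ℤ) → ℝ := fun k => ‖fc g k‖ ^ 2 + latNorm k ^ (-(7 / 2) : ℝ) with hT
  have hTs : HasSum T (I + S) := hP.add hS.hasSum
  have hT0 : ∀ k, 0 ≤ T k := fun k =>
    add_nonneg (sq_nonneg _) (Real.rpow_nonneg (norm_nonneg _) _)
  have hb : ∀ k, ‖fc q k‖ * latNorm k ^ (1 / 4 : ℝ) ≤ T k ∧ ‖fc q k‖ ≤ T k := by
    intro k
    by_cases hk0 : k = 0
    · subst hk0
      simp only [hq0, norm_zero, zero_mul]
      exact ⟨hT0 0, hT0 0⟩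
    have hn := one_le_latNorm hk0
    have hn0 : 0 < latNorm k := by linarith
    have h1 : latNorm k ^ 2 * ‖fc q k‖ ≤ ‖fc g k‖ :=
      (mul_le_mul_of_nonneg_right (latNorm_sq_le k) (norm_nonneg _)).trans (hk k)
    have h2 : 1 ≤ latNorm k ^ (1 / 4 : ℝ) := Real.one_le_rpow hn (by norm_num)
    have h3 : latNorm k ^ (1 / 4 : ℝ) = latNorm k ^ 2 * latNorm k ^ (-(7 / 4) : ℝ) := by
      rw [← Real.rpow_natCast, ← Real.rpow_add hn0]
      norm_num
    have h4 : latNorm k ^ (-(7 / 2) : ℝ) = (latNorm k ^ (-(7 / 4) : ℝ)) ^ 2 := by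
      rw [← Real.rpow_natCast, ← Real.rpow_mul hn0.le]
      norm_num
    have h5 : 0 < latNorm k ^ (-(7 / 4) : ℝ) := Real.rpow_pos_of_pos hn0 _
    have h6 : ‖fc q k‖ * latNorm k ^ (1 / 4 : ℝ) ≤ ‖fc g k‖ * latNorm k ^ (-(7 / 4) : ℝ) := by
      rw [h3]
      nlinarith
    have h7 : ‖fc q k‖ * latNorm k ^ (1 / 4 : ℝ) ≤ T k := by
      simp only [hT, h4]
      nlinarith [sq_nonneg (‖fc g k‖ - latNorm k ^ (-(7 / 4) : ℝ)), sq_nonneg ‖fc g k‖,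
        sq_nonneg (latNorm k ^ (-(7 / 4) : ℝ))]
    exact ⟨h7, le_trans (by nlinarith [norm_nonneg (fc q k)]) h7⟩
  have hsum : Summable fun k => ‖fc q k‖ :=
    hTs.summable.of_nonneg_of_le (fun _ => norm_nonneg _) fun k => (hb k).2
  have hIS : I + S ≤ (1 + S) * (1 + I) := by nlinarith
  constructor
  · intro p
    have h1 := fourier_expansion hq hsum p
    have h2 : ‖(q p : ℂ)‖ ≤ I + S := by
      rw [← h1.tsum_eq]
      refine tsum_of_norm_bounded hTs fun k => ?_
      rw [norm_mul, Complex.norm_exp_ofReal_mul_I, mul_one]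
      exact (hb k).2
    rw [Complex.norm_real, Real.norm_eq_abs] at h2
    nlinarith
  · intro p h
    have hE : 0 ≤ enorm3 h := Real.sqrt_nonneg _
    have h1 := (fourier_expansion hq hsum (p + h)).sub (fourier_expansion hq hsum p)
    have h2 : ‖(q (p + h) - q p : ℂ)‖ ≤ 40 * enorm3 h ^ (1 / 4 : ℝ) * (I + S) := by
      rw [← h1.tsum_eq]
      refine tsum_of_norm_bounded (hTs.mul_left _) fun k => ?_
      rw [phase_add, Complex.ofReal_add, add_mul, Complex.exp_add,
        show ∀ a b c : ℂ, a * (b * c) - a * b = a * b * (c - 1) by intros; ring, norm_mul,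
        norm_mul, Complex.norm_exp_ofReal_mul_I, mul_one]
      have h3 : |phase k h| ^ (1 / 4 : ℝ)
          ≤ 20 * (latNorm k ^ (1 / 4 : ℝ) * enorm3 h ^ (1 / 4 : ℝ)) := by
        have hl : 0 ≤ latNorm k := norm_nonneg _
        calc |phase k h| ^ (1 / 4 : ℝ) ≤ (20 * (latNorm k * enorm3 h)) ^ (1 / 4 : ℝ) :=
              Real.rpow_le_rpow (abs_nonneg _) (abs_phase_le k h) (by norm_num)
          _ = 20 ^ (1 / 4 : ℝ) * (latNorm k ^ (1 / 4 : ℝ) * enorm3 h ^ (1 / 4 : ℝ)) := by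
              rw [Real.mul_rpow (by norm_num) (by positivity), Real.mul_rpow hl hE]
          _ ≤ _ := by
              gcongr
              calc (20 : ℝ) ^ (1 / 4 : ℝ) ≤ 20 ^ (1 : ℝ) :=
                    Real.rpow_le_rpow_of_exponent_le (by norm_num) (by norm_num)
                _ = 20 := Real.rpow_one _
      have hE' : 0 ≤ enorm3 h ^ (1 / 4 : ℝ) := Real.rpow_nonneg hE _
      calc ‖fc q k‖ * ‖Complex.exp (phase k h * Complex.I) - 1‖
          ≤ ‖fc q k‖ * (2 * (20 * (latNorm k ^ (1 / 4 : ℝ) * enorm3 h ^ (1 / 4 : ℝ)))) := by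
            gcongr
            exact (norm_exp_sub_one_le _).trans (by linarith)
        _ = 40 * enorm3 h ^ (1 / 4 : ℝ) * (‖fc q k‖ * latNorm k ^ (1 / 4 : ℝ)) := by ring
        _ ≤ _ := by
            gcongr
            exact (hb k).1
    rw [← Complex.ofReal_sub, Complex.norm_real, Real.norm_eq_abs] at h2
    have hE' : 0 ≤ enorm3 h ^ (1 / 4 : ℝ) := Real.rpow_nonneg hE _
    nlinarith

end HolderFromFourier

section SignAndOscillation

variable {F u : R3 → ℝ}

/-- The coefficient `u_xx + 1`. -/
def cA (u : R3 → ℝ) (p : R3) : ℝ := pd vx (pd vx u) p + 1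

/-- The coefficient `u_yy + u_tt + u_t + 1`. -/
def cB (u : R3 → ℝ) (p : R3) : ℝ := pd vy (pd vy u) p + pd vt (pd vt u) p + pd vt u p + 1

theorem cp_cA {n : ℕ} (hu : CP (n + 2) u) : CP n (cA u) :=
  ((hu.pd vx).pd vx).add (CP.const 1)

theorem cp_cB {n : ℕ} (hu : CP (n + 2) u) : CP n (cB u) :=
  ((((hu.pd vy).pd vy).add ((hu.pd vt).pd vt)).add ((hu.pd vt).mono (by omega))).add (CP.const 1)

theorem CYeq.mul_eq (h : CYeq F u) (p : R3) :
    cA u p * cB u p = Real.exp (F p) + pd vy (pd vx u) p ^ 2 + pd vt (pd vx u) p ^ 2 := by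
  have := h p
  simp only [cA, cB]
  linarith

theorem CYeq.cA_pos (h : CYeq F u) (hu : CP 2 u) (p : R3) : 0 < cA u p := by
  have hne : ∀ q, cA u q ≠ 0 := by
    intro q h0
    have := h.mul_eq q
    rw [h0, zero_mul] at this
    linarith [Real.exp_pos (F q), sq_nonneg (pd vy (pd vx u) q), sq_nonneg (pd vt (pd vx u) q)]
  obtain ⟨p0, hp0⟩ := (hu.mono (m := 0) (by norm_num)).neg.exists_max
  have h1 := hessian_nonpos_of_max (f := fun p => -u p) hu.neg.contDiff hp0 vx
  rw [pd_apply_neg, pd_apply_neg] at h1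
  have h2 : 0 ≤ cA u p0 := by simp only [cA]; linarith
  by_contra! hneg
  obtain ⟨q, -, hq⟩ := isPreconnected_univ.intermediate_value (Set.mem_univ p) (Set.mem_univ p0)
    (cp_cA (n := 0) hu).continuous.continuousOn ⟨hneg, h2⟩
  exact hne q hq

theorem CYeq.cB_pos (h : CYeq F u) (hu : CP 2 u) (p : R3) : 0 < cB u p := by
  have h1 := h.mul_eq p
  have h2 : 0 < cA u p * cB u p := by
    rw [h1]
    have := Real.exp_pos (F p)
    positivity
  exact (pos_iff_pos_of_mul_pos h2).mp (h.cA_pos hu p)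

theorem abs_pd_vx_le_one (hu : CP 2 u) (hA : ∀ p, 0 < cA u p) (p : R3) : |pd vx u p| ≤ 1 := by
  have hd : Differentiable ℝ u := (hu.mono (m := 1) (by norm_num)).differentiable (n := 0)
  have hd1 : Differentiable ℝ (pd vx u) := (CP.pd (n := 1) hu vx).differentiable (n := 0)
  have hl := hasDerivAt_line (e := vx) hd p
  have hl1 : ∀ s : ℝ, HasDerivAt (fun s : ℝ => pd vx u (p + s • vx) + s) (cA u (p + s • vx)) s :=
    fun s => (hasDerivAt_line (e := vx) hd1 p s).add (hasDerivAt_id s)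
  have hmono : Monotone fun s : ℝ => pd vx u (p + s • vx) + s :=
    monotone_of_hasDerivAt_nonneg hl1 fun s => (hA _).le
  obtain ⟨s, hs, hs0⟩ := exists_hasDerivAt_eq_zero (f := fun s : ℝ => u (p + s • vx))
    (f' := fun s => pd vx u (p + s • vx)) zero_lt_one
    (fun s _ => (hl s).continuousAt.continuousWithinAt)
    (by simp [(hu.periodic p).1]) (fun s _ => hl s)
  have h1 := hmono hs.1.le
  have h2 := hmono hs.2.le
  simp only [hs0, zero_smul, one_smul, add_zero] at h1 h2
  rw [((CP.pd (n := 1) hu vx).periodic p).1] at h2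
  exact abs_le.mpr ⟨by linarith [hs.1], by linarith [hs.2]⟩

/-- The mean of `f` along the `x`-circles. -/
def xMean (f : R3 → ℝ) (p : R3) : ℝ := ∫ s in (0 : ℝ)..1, f (p + s • vx)

theorem cp_xMean {f : R3 → ℝ} (hf : CP 0 f) : CP 0 (xMean f) := by
  refine ⟨?_, fun p => ?_⟩
  · rw [Nat.cast_zero, contDiff_zero]
    refine intervalIntegral.continuous_parametric_intervalIntegral_of_continuous' ?_ 0 1
    have := hf.continuous
    fun_prop
  · simp [xMean, add_right_comm p _ (_ • vx), hf.periodic _]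

theorem xMean_add_smul {f : R3 → ℝ} (hf : CP 0 f) (p : R3) (c : ℝ) :
    xMean f (p + c • vx) = xMean f p := by
  have hper : Function.Periodic (fun s : ℝ => f (p + s • vx)) 1 := fun s => by
    simp [add_smul, ← add_assoc, (hf.periodic _).1]
  have h := hper.intervalIntegral_add_eq c 0
  have h2 := intervalIntegral.integral_comp_add_left (fun s : ℝ => f (p + s • vx)) c (a := 0)
    (b := 1)
  rw [add_zero, h, zero_add] at h2
  simpa only [xMean, add_smul, add_assoc] using h2

theorem integral_xMean_mul {f g : R3 → ℝ} (hf : CP 0 f) (hg : CP 0 g)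
    (hgx : ∀ (p : R3) (s : ℝ), g (p + s • vx) = g p) :
    ∫ p in cube, xMean f p * g p = ∫ p in cube, f p * g p := by
  have h1 : ∀ s : ℝ, ∫ p in cube, f (p + s • vx) * g p = ∫ p in cube, f p * g p := by
    intro s
    rw [← (hf.mul hg).integral_comp_add (s • vx)]
    simp only [hgx]
  simp only [xMean, ← intervalIntegral.integral_mul_const]
  rw [← intervalIntegral_integral_swap]
  · simp [h1]
  · have h2 : Continuous (Function.uncurry fun (s : ℝ) (p : R3) => f (p + s • vx) * g p) := by
      have := hf.continuous
      have := hg.continuous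
      fun_prop
    rw [Measure.prod_restrict, ← Measure.volume_eq_prod, ← IntegrableOn]
    refine (h2.continuousOn.integrableOn_compact ((isCompact_Icc (a := 0) (b := 1)).prod
      isCompact_cube)).mono_set ?_
    rw [Set.uIoc_of_le zero_le_one]
    exact Set.prod_mono Set.Ioc_subset_Icc_self le_rfl

theorem fc_xMean_of_eq_zero {f : R3 → ℝ} (hf : CP 0 f) {k : Fin 3 → ℤ} (hk : k 0 = 0) :
    fc (xMean f) k = fc f k := by
  have h : ∀ (p : R3) (s : ℝ), phase k (p + s • vx) = phase k p := by
    intro p s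
    simp [phase, vx, hk]
  simp only [fc]
  rw [integral_xMean_mul hf (cp_cos_phase k) fun p s => by rw [h],
    integral_xMean_mul hf (cp_sin_phase k) fun p s => by rw [h]]

theorem fc_xMean_of_ne_zero {f : R3 → ℝ} (hf : CP 0 f) {k : Fin 3 → ℤ} (hk : k 0 ≠ 0) :
    fc (xMean f) k = 0 := by
  have hk' : (k 0 : ℝ) ≠ 0 := by exact_mod_cast hk
  have h : ∀ p : R3, phase k (p + (1 / (2 * k 0) : ℝ) • vx) = phase k p + Real.pi := by
    intro p
    simp [phase, vx]
    field_simp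
    ring
  have h1 := ((cp_xMean hf).mul (cp_cos_phase k)).integral_comp_add ((1 / (2 * k 0) : ℝ) • vx)
  have h2 := ((cp_xMean hf).mul (cp_sin_phase k)).integral_comp_add ((1 / (2 * k 0) : ℝ) • vx)
  simp only [h, xMean_add_smul hf, Real.cos_add_pi, Real.sin_add_pi, mul_neg, integral_neg] at h1 h2
  simp only [fc]
  rw [show ∫ p in cube, xMean f p * Real.cos (phase k p) = 0 by linarith,
    show ∫ p in cube, xMean f p * Real.sin (phase k p) = 0 by linarith]
  simp

theorem pd_vx_cB (hu : CP 4 u) : pd vx (cB u) = fun p =>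
    pd vy (pd vy (pd vx u)) p + pd vt (pd vt (pd vx u)) p + pd vt (pd vx u) p := by
  have hy := CP.pd (n := 3) hu vy
  have ht := CP.pd (n := 3) hu vt
  have hyy := (CP.pd (n := 2) hy vy).differentiable (n := 1)
  have htt := (CP.pd (n := 2) ht vt).differentiable (n := 1)
  have htd := ht.differentiable (n := 2)
  have c2 : ∀ {f}, CP 3 f → ContDiff ℝ 2 f := fun h => (h.mono (m := 2) (by norm_num)).contDiff
  change pd vx (fun p => pd vy (pd vy u) p + pd vt (pd vt u) p + pd vt u p + 1) = _
  rw [pd_apply_add ((hyy.fun_add htt).fun_add htd) (differentiable_const 1),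
    pd_apply_add (hyy.fun_add htt) htd, pd_apply_add hyy htt, pd_apply_const,
    pd_comm (e := vx) (c2 hy), pd_comm (e := vx) (c2 ht),
    pd_comm (e := vx) (e' := vy) (c2 (hu.mono (by norm_num))),
    pd_comm (e := vx) (e' := vt) (c2 (hu.mono (by norm_num)))]
  simp

/-- The Legendre-type transform of `u` in the variable `x`. -/
def legendre (u : R3 → ℝ) (p : R3) : ℝ := -u p + pd vx u p * pd vx u p * 2⁻¹

theorem cp_legendre {n : ℕ} (hu : CP (n + 1) u) : CP n (legendre u) :=
  (hu.mono (by omega)).neg.add (((hu.pd vx).mul (hu.pd vx)).mul (CP.const 2⁻¹))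

theorem pd_legendre (hu : CP 4 u) (e : R3) :
    pd e (legendre u) = fun p => -pd e u p + pd vx u p * pd e (pd vx u) p := by
  have hd := (hu.differentiable (n := 3))
  have hx := (CP.pd (n := 3) hu vx).differentiable (n := 2)
  change pd e (fun p => -u p + pd vx u p * pd vx u p * 2⁻¹) = _
  rw [pd_apply_add hd.fun_neg ((hx.fun_mul hx).fun_mul (differentiable_const _)), pd_apply_neg,
    pd_apply_mul (hx.fun_mul hx) (differentiable_const _), pd_apply_mul hx hx, pd_apply_const]
  funext p
  ring

theorem pd_pd_legendre (hu : CP 4 u) (e : R3) :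
    pd e (pd e (legendre u)) = fun p =>
      -pd e (pd e u) p + pd e (pd vx u) p ^ 2 + pd vx u p * pd e (pd e (pd vx u)) p := by
  have hd := (CP.pd (n := 3) hu e).differentiable (n := 2)
  have hxC := CP.pd (n := 3) hu vx
  have hx := hxC.differentiable (n := 2)
  have hxe := (CP.pd (n := 2) hxC e).differentiable (n := 1)
  rw [pd_legendre hu, pd_apply_add hd.fun_neg (hx.fun_mul hxe), pd_apply_neg, pd_apply_mul hx hxe]
  funext p
  ring

theorem CYeq.legendre_eq (h : CYeq F u) (hu : CP 4 u) (p : R3) :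
    pd vy (pd vy (legendre u)) p + pd vt (pd vt (legendre u)) p + pd vt (legendre u) p
      = 1 + -Real.exp (F p) + pd vx (fun p => pd vx u p * cB u p) p := by
  have hx := (CP.pd (n := 3) hu vx).differentiable (n := 2)
  have hB := (cp_cB (n := 2) hu).differentiable (n := 1)
  rw [pd_pd_legendre hu, pd_pd_legendre hu, pd_legendre hu, pd_apply_mul hx hB, pd_vx_cB hu]
  have h1 := h.mul_eq p
  simp only [cA, cB] at h1 ⊢
  linear_combination -h1

theorem CYeq.norm_fc_legendre_le (h : CYeq F u) (hF : CP 0 F) (hu : CP 4 u) {k : Fin 3 → ℤ}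
    (hk : k 0 = 0) :
    (∑ i, (k i : ℝ) ^ 2) * ‖fc (legendre u) k‖ ≤ ‖fc (fun p => 1 + -Real.exp (F p)) k‖ := by
  have hL : CP 3 (legendre u) := cp_legendre hu
  have hLy := CP.pd (n := 2) hL vy
  have hLt := CP.pd (n := 2) hL vt
  have hg : CP 0 fun p => 1 + -Real.exp (F p) := (CP.const 1).add hF.exp.neg
  have hZ : CP 1 fun p => pd vx u p * cB u p :=
    ((CP.pd (n := 3) hu vx).mono (by norm_num)).mul ((cp_cB (n := 2) hu).mono (by norm_num))
  have h1 : fc (fun p => pd vy (pd vy (legendre u)) p + pd vt (pd vt (legendre u)) p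
      + pd vt (legendre u) p) k = fc (fun p => 1 + -Real.exp (F p)) k := by
    rw [funext (h.legendre_eq hu), fc_add hg (CP.pd (n := 0) hZ vx), fc_pd hZ, phase_vx, hk]
    simp
  have c1 : ∀ {n f}, CP (n + 1) f → CP 1 f := fun h => h.mono (by omega)
  have c0 : ∀ {n f}, CP n f → CP 0 f := fun h => h.mono (by omega)
  rw [fc_add ((c0 (CP.pd (n := 1) hLy vy)).add (c0 (CP.pd (n := 1) hLt vt))) (c0 hLt),
    fc_add (c0 (CP.pd (n := 1) hLy vy)) (c0 (CP.pd (n := 1) hLt vt)), fc_pd (c1 hLy),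
    fc_pd (c1 hLt), fc_pd (c1 hL), fc_pd (c1 hL), phase_vy, phase_vt] at h1
  rw [← h1]
  have h2 : ((2 * Real.pi * k 1 : ℝ) : ℂ) * Complex.I * (((2 * Real.pi * k 1 : ℝ) : ℂ)
        * Complex.I * fc (legendre u) k)
      + ((2 * Real.pi * k 2 : ℝ) : ℂ) * Complex.I * (((2 * Real.pi * k 2 : ℝ) : ℂ)
        * Complex.I * fc (legendre u) k)
      + ((2 * Real.pi * k 2 : ℝ) : ℂ) * Complex.I * fc (legendre u) k
      = (((-(4 * Real.pi ^ 2 * ((k 1 : ℝ) ^ 2 + (k 2 : ℝ) ^ 2)) : ℝ) : ℂ)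
        + ((2 * Real.pi * k 2 : ℝ) : ℂ) * Complex.I) * fc (legendre u) k := by
    push_cast
    linear_combination 4 * Real.pi ^ 2 * ((k 1 : ℂ) ^ 2 + (k 2 : ℂ) ^ 2) * fc (legendre u) k
      * Complex.I_sq
  rw [h2, norm_mul]
  refine mul_le_mul_of_nonneg_right ?_ (norm_nonneg _)
  refine le_trans ?_ (Complex.abs_re_le_norm _)
  have h3 : ((((-(4 * Real.pi ^ 2 * ((k 1 : ℝ) ^ 2 + (k 2 : ℝ) ^ 2)) : ℝ) : ℂ)
        + ((2 * Real.pi * k 2 : ℝ) : ℂ) * Complex.I)).re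
      = -(4 * Real.pi ^ 2 * ((k 1 : ℝ) ^ 2 + (k 2 : ℝ) ^ 2)) := by
    rw [Complex.add_re, Complex.ofReal_re, Complex.re_ofReal_mul, Complex.I_re, mul_zero, add_zero]
  rw [h3, abs_neg, abs_of_nonneg (by positivity), Fin.sum_univ_three, hk]
  have : 1 ≤ 4 * Real.pi ^ 2 := by nlinarith [Real.pi_gt_three]
  simp only [Int.cast_zero]
  nlinarith [sq_nonneg (k 1 : ℝ), sq_nonneg (k 2 : ℝ)]

theorem abs_xMean_legendre_add_le (hu : CP 2 u) (hA : ∀ p, 0 < cA u p) (p : R3) :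
    |xMean (legendre u) p + u p| ≤ 2 := by
  have hL : CP 0 (legendre u) := cp_legendre (hu.mono (by norm_num))
  have hx := abs_pd_vx_le_one hu hA
  have hd : Differentiable ℝ u := (hu.mono (m := 1) (by norm_num)).differentiable (n := 0)
  have hc : Continuous fun s : ℝ => legendre u (p + s • vx) := by
    have := hL.continuous
    fun_prop
  have h1 : xMean (legendre u) p + u p
      = ∫ s in (0 : ℝ)..1, (legendre u (p + s • vx) + u p) := by
    rw [intervalIntegral.integral_add (hc.intervalIntegrable 0 1)
      (continuous_const.intervalIntegrable 0 1)]
    simp [xMean]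
  have h2 : ∀ s ∈ Set.uIoc (0 : ℝ) 1, ‖legendre u (p + s • vx) + u p‖ ≤ 2 := by
    intro s hs
    rw [Set.uIoc_of_le zero_le_one] at hs
    have h3 := (convex_univ (𝕜 := ℝ) (E := ℝ)).norm_image_sub_le_of_norm_hasDerivWithin_le
      (f := fun s : ℝ => u (p + s • vx)) (f' := fun s => pd vx u (p + s • vx)) (C := 1)
      (fun s _ => (hasDerivAt_line hd p s).hasDerivWithinAt) (fun s _ => hx _)
      (Set.mem_univ 0) (Set.mem_univ s)
    simp only [zero_smul, add_zero, sub_zero, one_mul, Real.norm_eq_abs, abs_of_pos hs.1] at h3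
    have h4 := abs_le.mp (h3.trans hs.2)
    have h5 := abs_le.mp (hx (p + s • vx))
    rw [Real.norm_eq_abs, abs_le, legendre]
    constructor <;> nlinarith
  rw [h1]
  simpa using intervalIntegral.norm_integral_le_of_norm_le_const h2

theorem exists_oscillation_bound (K : ℝ) : ∃ M : ℝ, 0 < M ∧ ∀ F u : R3 → ℝ, CP 0 F →
    (∀ p, |F p| ≤ K) → CP 4 u → CYeq F u → ∀ p q, u p - u q ≤ M := by
  obtain ⟨C, hC, hCq⟩ := exists_holder_const
  refine ⟨2 * (C * (1 + (1 + Real.exp K) ^ 2)) + 4, by positivity, fun F u hF hFK hu h p q => ?_⟩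
  have hL : CP 0 (legendre u) := cp_legendre (hu.mono (by norm_num))
  have hm := cp_xMean hL
  set c := ∫ p in cube, xMean (legendre u) p with hc
  have hg : CP 0 fun p => 1 + -Real.exp (F p) := (CP.const 1).add hF.exp.neg
  have hq0 : fc (fun p => xMean (legendre u) p + -c) 0 = 0 := by
    rw [fc_zero, integral_add hm.integrableOn (CP.const _).integrableOn, ← hc]
    simp [Measure.real, volume_cube]
  have hbound := (hCq (fun p => xMean (legendre u) p + -c) (fun p => 1 + -Real.exp (F p))
    (hm.add (CP.const _)) hg hq0 ?_).1
  · have hI : ∫ p in cube, (1 + -Real.exp (F p)) ^ 2 ≤ (1 + Real.exp K) ^ 2 := by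
      have h1 : ∫ p in cube, (1 + -Real.exp (F p)) ^ 2 ≤ ∫ p in cube, (1 + Real.exp K) ^ 2 := by
        refine integral_mono (hg.pow 2).integrableOn (CP.const _).integrableOn fun p => ?_
        have h2 := Real.exp_pos (F p)
        have h3 := Real.exp_le_exp.mpr (abs_le.mp (hFK p)).2
        exact sq_le_sq' (by linarith) (by linarith [Real.exp_pos K])
      simpa [Measure.real, volume_cube] using h1
    have hb : ∀ p, |xMean (legendre u) p + -c| ≤ C * (1 + (1 + Real.exp K) ^ 2) := fun p =>
      (hbound p).trans (by gcongr)
    have hA := h.cA_pos (hu.mono (by norm_num))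
    have e1 := abs_le.mp (abs_xMean_legendre_add_le (hu.mono (by norm_num)) hA p)
    have e2 := abs_le.mp (abs_xMean_legendre_add_le (hu.mono (by norm_num)) hA q)
    have e3 := abs_le.mp (hb p)
    have e4 := abs_le.mp (hb q)
    linarith
  · intro k
    by_cases hk : k = 0
    · subst hk
      rw [hq0]
      simp
    rw [fc_add hm (CP.const _), fc_const hk, add_zero]
    by_cases hk0 : k 0 = 0
    · rw [fc_xMean_of_eq_zero hL hk0]
      exact h.norm_fc_legendre_le hF hu hk0
    · rw [fc_xMean_of_ne_zero hL hk0]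
      simp

end SignAndOscillation

section MaximumPrinciple

variable {F u Q : R3 → ℝ}

/-- The linearization of the reduced Calabi–Yau operator at `u`. -/
def lin (u Q : R3 → ℝ) (p : R3) : ℝ :=
  cB u p * pd vx (pd vx Q) p + cA u p * (pd vy (pd vy Q) p + pd vt (pd vt Q) p + pd vt Q p)
    - 2 * pd vy (pd vx u) p * pd vy (pd vx Q) p - 2 * pd vt (pd vx u) p * pd vt (pd vx Q) p

theorem pd_comb (a b : ℝ) (e e' : R3) (f : R3 → ℝ) :
    pd (a • e + b • e') f = fun p => a * pd e f p + b * pd e' f p := by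
  rw [pd_add_dir, pd_smul_dir, pd_smul_dir]

theorem pd_pd_comb (hQ : ContDiff ℝ 2 Q) (a b : ℝ) (e e' : R3) (p : R3) :
    pd (a • e + b • e') (pd (a • e + b • e') Q) p
      = a ^ 2 * pd e (pd e Q) p + 2 * a * b * pd e (pd e' Q) p + b ^ 2 * pd e' (pd e' Q) p := by
  have hd : ∀ e, Differentiable ℝ (pd e Q) := fun e =>
    (contDiff_pd (n := 1) (by exact_mod_cast hQ)).differentiable (by norm_num)
  rw [pd_comb, pd_comb, pd_apply_add ((hd e).const_mul a) ((hd e').const_mul b),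
    pd_apply_add ((hd e).const_mul a) ((hd e').const_mul b),
    pd_apply_mul (differentiable_const _) (hd e), pd_apply_mul (differentiable_const _) (hd e'),
    pd_apply_mul (differentiable_const _) (hd e), pd_apply_mul (differentiable_const _) (hd e'),
    pd_apply_const, pd_apply_const, pd_apply_const, pd_apply_const, pd_comm (e := e') (e' := e) hQ]
  ring

theorem CYeq.lin_nonpos_of_max (h : CYeq F u) (hu : CP 2 u) (hQ : ContDiff ℝ 2 Q) {p : R3}
    (hp : ∀ q, Q q ≤ Q p) : lin u Q p ≤ 0 := by
  have hA := h.cA_pos hu p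
  have h1 := hessian_nonpos_of_max hQ hp (cA u p • vy + (-pd vy (pd vx u) p) • vx)
  have h2 := hessian_nonpos_of_max hQ hp (cA u p • vt + (-pd vt (pd vx u) p) • vx)
  have h3 := hessian_nonpos_of_max hQ hp vx
  have h4 := pd_eq_zero_of_max hp vt
  rw [pd_pd_comb hQ] at h1 h2
  have h5 := h.mul_eq p
  have h6 : cA u p * lin u Q p ≤ 0 := by
    have h7 : cA u p * lin u Q p = Real.exp (F p) * pd vx (pd vx Q) p
        + (cA u p ^ 2 * pd vy (pd vy Q) p
          + 2 * cA u p * (-pd vy (pd vx u) p) * pd vy (pd vx Q) p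
          + (-pd vy (pd vx u) p) ^ 2 * pd vx (pd vx Q) p)
        + (cA u p ^ 2 * pd vt (pd vt Q) p
          + 2 * cA u p * (-pd vt (pd vx u) p) * pd vt (pd vx Q) p
          + (-pd vt (pd vx u) p) ^ 2 * pd vx (pd vx Q) p) := by
      simp only [lin, h4]
      linear_combination pd vx (pd vx Q) p * h5
    have := mul_nonpos_of_nonneg_of_nonpos (Real.exp_pos (F p)).le h3
    linarith
  exact nonpos_of_mul_nonpos_right h6 hA

theorem lin_add {Q' : R3 → ℝ} (hQ : ContDiff ℝ 2 Q) (hQ' : ContDiff ℝ 2 Q') :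
    lin u (fun p => Q p + Q' p) = fun p => lin u Q p + lin u Q' p := by
  have hd : Differentiable ℝ Q := hQ.differentiable (by norm_num)
  have hd' : Differentiable ℝ Q' := hQ'.differentiable (by norm_num)
  have hpd : ∀ e, Differentiable ℝ (pd e Q) := fun e =>
    (contDiff_pd (n := 1) (by exact_mod_cast hQ)).differentiable (by norm_num)
  have hpd' : ∀ e, Differentiable ℝ (pd e Q') := fun e =>
    (contDiff_pd (n := 1) (by exact_mod_cast hQ')).differentiable (by norm_num)
  funext p
  simp only [lin, pd_apply_add hd hd', pd_apply_add (hpd _) (hpd' _)]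
  ring

theorem lin_neg : lin u (fun p => -Q p) = fun p => -lin u Q p := by
  funext p
  simp only [lin, pd_apply_neg]
  ring

theorem CYeq.lin_self (h : CYeq F u) (p : R3) :
    lin u u p = 2 * Real.exp (F p) - cA u p - cB u p := by
  have h1 := h.mul_eq p
  simp only [lin, cA, cB] at h1 ⊢
  linear_combination 2 * h1

theorem pd_comm3 {f : R3 → ℝ} (hf : ContDiff ℝ 3 f) (e e' e'' : R3) :
    pd e (pd e' (pd e'' f)) = pd e'' (pd e (pd e' f)) := by
  rw [pd_comm (e := e') (hf.of_le (by norm_num)),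
    pd_comm (e := e) (e' := e'') (contDiff_pd (n := 2) (by exact_mod_cast hf))]

theorem pd_cA (hu : CP 3 u) (e : R3) : pd e (cA u) = pd vx (pd vx (pd e u)) := by
  have hd := (CP.pd (n := 1) (CP.pd (n := 2) hu vx) vx).differentiable (n := 0)
  change pd e (fun p => pd vx (pd vx u) p + 1) = _
  rw [pd_apply_add hd (differentiable_const 1), pd_apply_const, pd_comm3 hu.contDiff vx vx e]
  simp

theorem pd_cB (hu : CP 3 u) (e : R3) : pd e (cB u) = fun p =>
    pd vy (pd vy (pd e u)) p + pd vt (pd vt (pd e u)) p + pd vt (pd e u) p := by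
  have hy := CP.pd (n := 2) hu vy
  have ht := CP.pd (n := 2) hu vt
  have hyy := (CP.pd (n := 1) hy vy).differentiable (n := 0)
  have htt := (CP.pd (n := 1) ht vt).differentiable (n := 0)
  have htd := ht.differentiable (n := 1)
  change pd e (fun p => pd vy (pd vy u) p + pd vt (pd vt u) p + pd vt u p + 1) = _
  rw [pd_apply_add ((hyy.fun_add htt).fun_add htd) (differentiable_const 1),
    pd_apply_add (hyy.fun_add htt) htd, pd_apply_add hyy htt, pd_apply_const,
    pd_comm3 hu.contDiff vy vy e, pd_comm3 hu.contDiff vt vt e,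
    pd_comm (e := vt) (e' := e) (hu.mono (m := 2) (by norm_num)).contDiff]
  simp

/-- The first derivative of the equation. -/
theorem CYeq.pd_eq (h : CYeq F u) (hF : CP 1 F) (hu : CP 3 u) (e p : R3) :
    cA u p * pd e (cB u) p + cB u p * pd e (cA u) p
      - 2 * pd vy (pd vx u) p * pd e (pd vy (pd vx u)) p
      - 2 * pd vt (pd vx u) p * pd e (pd vt (pd vx u)) p = Real.exp (F p) * pd e F p := by
  have hA := (cp_cA (n := 1) hu).differentiable (n := 0)
  have hB := (cp_cB (n := 1) hu).differentiable (n := 0)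
  have hb : ∀ e, Differentiable ℝ (pd e (pd vx u)) := fun e =>
    (CP.pd (n := 1) (CP.pd (n := 2) hu vx) e).differentiable (n := 0)
  have h1 := congrArg (pd e) (funext h.mul_eq)
  rw [pd_apply_mul hA hB, pd_apply_add ((hF.exp.differentiable (n := 0)).fun_add ((hb vy).fun_pow 2))
    ((hb vt).fun_pow 2), pd_apply_add (hF.exp.differentiable (n := 0)) ((hb vy).fun_pow 2),
    pd_apply_pow 2 (hb vy), pd_apply_pow 2 (hb vt),
    pd_apply_exp (hF.differentiable (n := 0))] at h1
  have h2 := congrFun h1 p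
  norm_num at h2
  linarith

theorem CYeq.lin_pd (h : CYeq F u) (hF : CP 1 F) (hu : CP 3 u) (e p : R3) :
    lin u (pd e u) p = Real.exp (F p) * pd e F p := by
  rw [← h.pd_eq hF hu, pd_cA hu, pd_cB hu, pd_comm3 hu.contDiff e vy vx,
    pd_comm3 hu.contDiff e vt vx]
  simp only [lin]
  rw [pd_comm (e := vy) (e' := vx) (contDiff_pd (n := 2) hu.contDiff),
    pd_comm (e := vt) (e' := vx) (contDiff_pd (n := 2) hu.contDiff),
    pd_comm (e := e) (e' := vy) (hu.mono (m := 2) (by norm_num)).contDiff,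
    pd_comm (e := e) (e' := vt) (hu.mono (m := 2) (by norm_num)).contDiff]
  ring

/-- Reverse Cauchy–Schwarz inequality for the Lorentzian form `AB - b₁² - b₂²`. -/
theorem reverse_cauchy_schwarz {A B b₁ b₂ E a β c₁ c₂ : ℝ} (hA : 0 < A) (hE : 0 < E)
    (h : A * B = E + b₁ ^ 2 + b₂ ^ 2) :
    4 * E * (a * β - c₁ ^ 2 - c₂ ^ 2) ≤ (A * β + B * a - 2 * b₁ * c₁ - 2 * b₂ * c₂) ^ 2 := by
  have key : A ^ 2 * ((A * β + B * a - 2 * b₁ * c₁ - 2 * b₂ * c₂) ^ 2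
        - 4 * E * (a * β - c₁ ^ 2 - c₂ ^ 2))
      = (A * (A * β + B * a - 2 * b₁ * c₁ - 2 * b₂ * c₂) - 2 * a * E) ^ 2
        + 4 * E * ((A * c₁ - a * b₁) ^ 2 + (A * c₂ - a * b₂) ^ 2) := by
    linear_combination 4 * E * a ^ 2 * h
  have h1 : 0 ≤ A ^ 2 * ((A * β + B * a - 2 * b₁ * c₁ - 2 * b₂ * c₂) ^ 2
        - 4 * E * (a * β - c₁ ^ 2 - c₂ ^ 2)) := by
    rw [key]
    positivity
  exact sub_nonneg.mp (nonneg_of_mul_nonneg_right h1 (by positivity))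

theorem CYeq.lin_pd_pd (h : CYeq F u) (hF : CP 2 F) (hu : CP 4 u) (e p : R3) :
    Real.exp (F p) * pd e (pd e F) p ≤ lin u (pd e (pd e u)) p := by
  have hF1 : CP 1 F := hF.mono (by norm_num)
  have hu3 : CP 3 u := hu.mono (by norm_num)
  have hue := CP.pd (n := 3) hu e
  have cA2 := cp_cA (n := 2) hu
  have cB2 := cp_cB (n := 2) hu
  have cb2 : ∀ e, CP 2 (pd e (pd vx u)) := fun e => CP.pd (n := 2) (CP.pd (n := 3) hu vx) e
  have hA := cA2.differentiable (n := 1)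
  have hB := cB2.differentiable (n := 1)
  have hb : ∀ e, Differentiable ℝ (pd e (pd vx u)) := fun e => (cb2 e).differentiable (n := 1)
  have hAe := (CP.pd (n := 1) cA2 e).differentiable (n := 0)
  have hBe := (CP.pd (n := 1) cB2 e).differentiable (n := 0)
  have hbe : ∀ e', Differentiable ℝ (pd e (pd e' (pd vx u))) := fun e' =>
    (CP.pd (n := 1) (cb2 e') e).differentiable (n := 0)
  have hFe := (CP.pd (n := 1) hF e).differentiable (n := 0)
  have h1 := congrArg (pd e) (funext (h.pd_eq hF1 hu3 e))
  have k2 : ∀ e, Differentiable ℝ fun p => 2 * pd e (pd vx u) p := fun e => (hb e).const_mul 2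
  have m1 := hA.fun_mul hBe
  have m2 := hB.fun_mul hAe
  have m3 := (k2 vy).fun_mul (hbe vy)
  have m4 := (k2 vt).fun_mul (hbe vt)
  rw [pd_apply_sub ((m1.fun_add m2).fun_sub m3) m4, pd_apply_sub (m1.fun_add m2) m3,
    pd_apply_add m1 m2, pd_apply_mul hA hBe, pd_apply_mul hB hAe, pd_apply_mul (k2 vy) (hbe vy),
    pd_apply_mul (k2 vt) (hbe vt), pd_apply_mul (differentiable_const 2) (hb vy),
    pd_apply_mul (differentiable_const 2) (hb vt), pd_apply_const,
    pd_apply_mul (hF1.exp.differentiable (n := 0)) hFe,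
    pd_apply_exp (hF1.differentiable (n := 0))] at h1
  have h2 := congrFun h1 p
  have h3 := reverse_cauchy_schwarz (a := pd e (cA u) p) (β := pd e (cB u) p)
    (c₁ := pd e (pd vy (pd vx u)) p) (c₂ := pd e (pd vt (pd vx u)) p)
    (h.cA_pos (hu.mono (by norm_num)) p) (Real.exp_pos (F p)) (h.mul_eq p)
  rw [h.pd_eq hF1 hu3 e p] at h3
  have h4 : pd e (cA u) p * pd e (cB u) p - pd e (pd vy (pd vx u)) p ^ 2
      - pd e (pd vt (pd vx u)) p ^ 2 ≤ Real.exp (F p) * pd e F p ^ 2 / 4 := by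
    have := Real.exp_pos (F p)
    refine le_of_mul_le_mul_left ?_ this
    linarith
  have eA : pd e (pd e (cA u)) = pd vx (pd vx (pd e (pd e u))) := by
    rw [pd_cA hu3, pd_comm3 hue.contDiff vx vx e]
  have eB : pd e (pd e (cB u)) = fun p => pd vy (pd vy (pd e (pd e u))) p
      + pd vt (pd vt (pd e (pd e u))) p + pd vt (pd e (pd e u)) p := by
    have hy := CP.pd (n := 2) hue vy
    have ht := CP.pd (n := 2) hue vt
    have hyy := (CP.pd (n := 1) hy vy).differentiable (n := 0)
    have htt := (CP.pd (n := 1) ht vt).differentiable (n := 0)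
    have htd := ht.differentiable (n := 1)
    rw [pd_cB hu3, pd_apply_add (hyy.fun_add htt) htd, pd_apply_add hyy htt,
      pd_comm3 hue.contDiff vy vy e, pd_comm3 hue.contDiff vt vt e,
      pd_comm (e := vt) (e' := e) (hue.mono (m := 2) (by norm_num)).contDiff]
  have eb : ∀ e', pd e (pd e (pd e' (pd vx u))) = pd e' (pd vx (pd e (pd e u))) := by
    intro e'
    rw [pd_comm3 (CP.pd (n := 3) hu vx).contDiff e e e',
      pd_comm3 hu3.contDiff e e vx]
  rw [eA, eB, eb, eb] at h2
  simp only [lin]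
  have := Real.exp_pos (F p)
  have : 0 ≤ Real.exp (F p) * pd e F p ^ 2 := by positivity
  linarith

theorem CYeq.le_of_lin {K M c : ℝ} (h : CYeq F u) (hu : CP 2 u) (hF : ∀ p, |F p| ≤ K)
    (hc : 0 ≤ c) (hM : ∀ p q, u p - u q ≤ M) (hQ : CP 2 Q)
    (hlin : ∀ p, -(c * Real.exp (F p)) ≤ lin u Q p) (hQAB : ∀ p, Q p ≤ cA u p + cB u p) (q : R3) :
    Q q ≤ (2 + c) * Real.exp K + M := by
  have hC := hQ.add hu.neg
  obtain ⟨p, hp⟩ := (hC.mono (m := 0) (by norm_num)).exists_max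
  have h1 := h.lin_nonpos_of_max hu hC.contDiff hp
  rw [lin_add hQ.contDiff hu.neg.contDiff, lin_neg] at h1
  have h2 := h.lin_self p
  have h3 := hlin p
  have h4 : Real.exp (F p) ≤ Real.exp K := Real.exp_le_exp.mpr (abs_le.mp (hF p)).2
  have h5 := hp q
  have h6 := hM q p
  have h7 := hQAB p
  have h8 := mul_le_mul_of_nonneg_left h4 hc
  dsimp only at h1
  linarith

end MaximumPrinciple

/-- Uniform ellipticity of the linearized operator. -/
theorem exists_ellipticity_bound (K : ℝ) : ∃ Λ : ℝ, 1 ≤ Λ ∧ ∀ F u : R3 → ℝ, CP 2 F →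
    C2Bound F K → CP 4 u → CYeq F u → ∀ p, cA u p ≤ Λ ∧ cB u p ≤ Λ := by
  obtain ⟨M, hM, hosc⟩ := exists_oscillation_bound K
  refine ⟨(2 + 3 * |K|) * Real.exp K + M + 1, ?_, fun F u hF hFK hu h p => ?_⟩
  · have : 0 ≤ (2 + 3 * |K|) * Real.exp K := by positivity
    linarith
  have hFK0 : ∀ p, |F p| ≤ K := fun p => (hFK p).1
  have hK : 0 ≤ K := (abs_nonneg _).trans (hFK0 0)
  rw [abs_of_nonneg hK]
  have hu2 : CP 2 u := hu.mono (by norm_num)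
  have hpos := fun p => h.cA_pos hu2 p
  have hposB := fun p => h.cB_pos hu2 p
  have hE := Real.exp_pos K
  have hlin2 : ∀ e ∈ ({vx, vy, vt} : Set R3), ∀ p,
      -(K * Real.exp (F p)) ≤ lin u (pd e (pd e u)) p := by
    intro e he p
    have h1 := h.lin_pd_pd hF hu e p
    have h2 := abs_le.mp ((hFK p).2.2 e he e he)
    have h3 := Real.exp_pos (F p)
    nlinarith
  have c2 : ∀ e, CP 2 (pd e (pd e u)) := fun e => CP.pd (n := 2) (CP.pd (n := 3) hu e) e
  have ct : CP 2 (pd vt u) := (CP.pd (n := 3) hu vt).mono (by norm_num)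
  constructor
  · have h1 := h.le_of_lin (Q := pd vx (pd vx u)) (c := K) hu2 hFK0 hK (hosc F u (hF.mono
      (by norm_num)) hFK0 hu h) (c2 vx) (hlin2 vx (by simp))
      (fun p => by have := hposB p; simp only [cA]; linarith) p
    simp only [cA]
    nlinarith
  · have h1 := h.le_of_lin (Q := fun p => pd vy (pd vy u) p + pd vt (pd vt u) p + pd vt u p)
      (c := 3 * K) hu2 hFK0 (by positivity) (hosc F u (hF.mono (by norm_num)) hFK0 hu h)
      (((c2 vy).add (c2 vt)).add ct) (fun p => ?_)
      (fun p => by have := hpos p; simp only [cB]; linarith) p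
    · simp only [cB]
      linarith
    · rw [lin_add ((c2 vy).add (c2 vt)).contDiff ct.contDiff,
        lin_add (c2 vy).contDiff (c2 vt).contDiff]
      have e1 := hlin2 vy (by simp) p
      have e2 := hlin2 vt (by simp) p
      have e3 := h.lin_pd (hF.mono (by norm_num)) (hu.mono (by norm_num)) vt p
      have e4 := abs_le.mp ((hFK p).2.1 vt (by simp))
      have e5 := Real.exp_pos (F p)
      dsimp only
      rw [e3]
      nlinarith

theorem CP.sum {ι : Type*} [Fintype ι] {n : ℕ} {f : ι → R3 → ℝ} (hf : ∀ i, CP n (f i)) :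
    CP n (fun p => ∑ i, f i p) :=
  ⟨ContDiff.sum fun i _ => (hf i).contDiff, fun p => by simp [(hf _).periodic p]⟩

section LegendreDerivatives

/-- The coordinate directions fixed by the partial Legendre transform, preceded by `0`. -/
def dir : Fin 3 → R3 := ![0, vy, vt]

/-- The derivative along the `i`-th coordinate of the partial Legendre transform. -/
def D (w : Fin 3 → R3 → ℝ) (i : Fin 3) (f : R3 → ℝ) (p : R3) : ℝ :=
  pd (dir i) f p + w i p * pd vx f p

variable {L : ℝ} {A a f g : R3 → ℝ} {w : Fin 3 → R3 → ℝ} {i j : Fin 3}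

theorem CP.D {n : ℕ} (hw : ∀ i, CP n (w i)) (hf : CP (n + 1) f) (i : Fin 3) : CP n (D w i f) :=
  (hf.pd _).add ((hw i).mul (hf.pd _))

theorem D_add (hf : Differentiable ℝ f) (hg : Differentiable ℝ g) :
    D w i (fun p => f p + g p) = fun p => D w i f p + D w i g p := by
  funext p
  simp only [D, pd_apply_add hf hg]
  ring

theorem D_const (c : ℝ) : D w i (fun _ => c) = fun _ => 0 := by
  funext p
  simp [D, pd_apply_const]

theorem D_mul (hf : Differentiable ℝ f) (hg : Differentiable ℝ g) :
    D w i (fun p => f p * g p) = fun p => f p * D w i g p + g p * D w i f p := by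
  funext p
  simp only [D, pd_apply_mul hf hg]
  ring

theorem D_pow (n : ℕ) (hf : Differentiable ℝ f) :
    D w i (fun p => f p ^ n) = fun p => n * f p ^ (n - 1) * D w i f p := by
  funext p
  simp only [D, pd_apply_pow n hf]
  ring

/-- The coefficients of the partial Legendre transform of a solution, with a bound `L`. -/
structure LegendreData (L : ℝ) (A : R3 → ℝ) (w : Fin 3 → R3 → ℝ) (a : R3 → ℝ) : Prop where
  cpA : CP 2 A
  cpw : ∀ i, CP 2 (w i)
  cpa : CP 2 a
  div_eq_zero : ∀ i p, pd (dir i) A p + pd vx (fun p => A p * w i p) p = 0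
  curl_eq : ∀ i j p, pd (dir i) (fun p => A p * w j p) p = pd (dir j) (fun p => A p * w i p) p
  mul_w_zero : ∀ p, A p * w 0 p = 1
  eqn : ∀ p, a p * D w 0 (w 0) p + D w 0 a p * w 0 p + D w 1 (w 1) p + D w 2 (w 2) p + w 2 p = 0
  one_le : 1 ≤ L
  A_le : ∀ p, A p ≤ L
  inv_le_A : ∀ p, L⁻¹ ≤ A p
  abs_w_le : ∀ i p, |w i p| ≤ L
  a_le : ∀ p, a p ≤ L
  inv_le_a : ∀ p, L⁻¹ ≤ a p
  abs_pd_a_le : ∀ e ∈ ({vx, vy, vt} : Set R3), ∀ p, |pd e a p| ≤ L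
  abs_pd_pd_a_le : ∀ e ∈ ({vx, vy, vt} : Set R3), ∀ e' ∈ ({vx, vy, vt} : Set R3),
    ∀ p, |pd e (pd e' a) p| ≤ L

namespace LegendreData

theorem L_pos (h : LegendreData L A w a) : 0 < L := zero_lt_one.trans_le h.one_le

theorem A_pos (h : LegendreData L A w a) (p : R3) : 0 < A p :=
  (inv_pos.mpr h.L_pos).trans_le (h.inv_le_A p)

theorem a_pos (h : LegendreData L A w a) (p : R3) : 0 < a p :=
  (inv_pos.mpr h.L_pos).trans_le (h.inv_le_a p)

theorem pd_dir_A (h : LegendreData L A w a) (i : Fin 3) (p : R3) :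
    pd (dir i) A p = -(A p * pd vx (w i) p + w i p * pd vx A p) := by
  have h1 := h.div_eq_zero i p
  rw [pd_apply_mul (h.cpA.differentiable (n := 1)) ((h.cpw i).differentiable (n := 1))] at h1
  linarith

theorem curl_eq' (h : LegendreData L A w a) (i j : Fin 3) (p : R3) :
    A p * pd (dir i) (w j) p + w j p * pd (dir i) A p
      = A p * pd (dir j) (w i) p + w i p * pd (dir j) A p := by
  have h1 := h.curl_eq i j p
  rwa [pd_apply_mul (h.cpA.differentiable (n := 1)) ((h.cpw i).differentiable (n := 1)),
    pd_apply_mul (h.cpA.differentiable (n := 1)) ((h.cpw j).differentiable (n := 1))] at h1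

theorem D_w_symm (h : LegendreData L A w a) (i j : Fin 3) : D w i (w j) = D w j (w i) := by
  funext p
  have h1 := h.curl_eq' i j p
  rw [h.pd_dir_A, h.pd_dir_A] at h1
  refine mul_left_cancel₀ (h.A_pos p).ne' ?_
  simp only [D]
  linear_combination h1

theorem D_comm (h : LegendreData L A w a) (hf : CP 2 f) (i j : Fin 3) :
    D w i (D w j f) = D w j (D w i f) := by
  funext p
  have hpd : ∀ e, Differentiable ℝ (pd e f) := fun e => (CP.pd (n := 1) hf e).differentiable (n := 0)
  have hw : ∀ i, Differentiable ℝ (w i) := fun i => (h.cpw i).differentiable (n := 1)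
  have key : ∀ i j, D w i (D w j f) p = D w i (w j) p * pd vx f p
      + (pd (dir i) (pd (dir j) f) p + w i p * pd vx (pd (dir j) f) p
        + w j p * pd (dir i) (pd vx f) p + w i p * w j p * pd vx (pd vx f) p) := by
    intro i j
    change D w i (fun p => pd (dir j) f p + w j p * pd vx f p) p = _
    rw [D_add (hpd _) ((hw j).fun_mul (hpd vx)), D_mul (hw j) (hpd vx)]
    simp only [D]
    ring
  rw [key, key, h.D_w_symm j i, pd_comm (e := dir j) (e' := dir i) hf.contDiff,
    pd_comm (e := vx) (e' := dir j) hf.contDiff, pd_comm (e := dir i) (e' := vx) hf.contDiff]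
  ring

theorem integral_D (h : LegendreData L A w a) (hf : CP 1 f) (i : Fin 3) :
    ∫ p in cube, A p * D w i f p = 0 := by
  have cA1 : CP 1 A := h.cpA.mono (by norm_num)
  have cw1 : CP 1 fun p => A p * w i p := cA1.mul ((h.cpw i).mono (by norm_num))
  have hpd : ∀ {f e}, CP 1 f → CP 0 (pd e f) := fun hf => CP.pd (n := 0) hf _
  have c0 : ∀ {f}, CP 1 f → CP 0 f := fun hf => hf.mono (by norm_num)
  have h1 := integral_pd_mul hf cA1 (dir i)
  have h2 := integral_pd_mul hf cw1 vx
  have h3 : ∀ p, A p * D w i f p = pd (dir i) f p * A p + pd vx f p * (A p * w i p) := by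
    intro p
    simp only [D]
    ring
  simp only [h3]
  rw [integral_add ((hpd hf).mul (c0 cA1)).integrableOn ((hpd hf).mul (c0 cw1)).integrableOn,
    h1, h2, ← neg_add, ← integral_add ((c0 hf).mul (hpd cA1)).integrableOn
      ((c0 hf).mul (hpd cw1)).integrableOn]
  simp only [← mul_add, h.div_eq_zero]
  simp

end LegendreData

/-- The Jacobian determinant of a pair of functions in the directions `e` and `e'`. -/
def jac (e e' : R3) (f g : R3 → ℝ) (p : R3) : ℝ := pd e f p * pd e' g p - pd e' f p * pd e g p

theorem cp_jac (e e' : R3) (hf : CP 1 f) (hg : CP 1 g) : CP 0 (jac e e' f g) :=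
  ((CP.pd (n := 0) hf e).mul (CP.pd (n := 0) hg e')).sub
    ((CP.pd (n := 0) hf e').mul (CP.pd (n := 0) hg e))

theorem integral_jac (e e' : R3) (hf : CP 1 f) (hg : CP 1 g) :
    ∫ p in cube, jac e e' f g p = 0 := by
  simp only [jac]
  rw [integral_sub ((CP.pd (n := 0) hf e).mul (CP.pd (n := 0) hg e')).integrableOn
    ((CP.pd (n := 0) hf e').mul (CP.pd (n := 0) hg e)).integrableOn,
    integral_pd_mul_pd_comm hf hg, sub_self]

theorem integral_mul_jac {φ : R3 → ℝ} (e e' : R3) (hφ : CP 1 φ) (hf : CP 1 f) (hg : CP 1 g) :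
    ∫ p in cube, φ p * jac e e' f g p = -∫ p in cube, f p * jac e e' φ g p := by
  have c0 : ∀ {f}, CP 1 f → CP 0 f := fun hf => hf.mono (by norm_num)
  have h1 := integral_jac e e' (hφ.mul hf) hg
  have h2 : ∀ p, jac e e' (fun p => φ p * f p) g p
      = φ p * jac e e' f g p + f p * jac e e' φ g p := by
    intro p
    simp only [jac, pd_apply_mul (hφ.differentiable (n := 0)) (hf.differentiable (n := 0))]
    ring
  simp only [h2] at h1
  rw [integral_add ((c0 hφ).mul (cp_jac e e' hf hg)).integrableOn
    ((c0 hf).mul (cp_jac e e' hφ hg)).integrableOn] at h1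
  linarith

theorem LegendreData.integral_D_mul_D (h : LegendreData L A w a) (hf : CP 1 f) (hg : CP 1 g)
    (i j : Fin 3) :
    ∫ p in cube, A p * (D w i f p * D w j g p - D w j f p * D w i g p) = 0 := by
  have c0 : ∀ {f}, CP 1 f → CP 0 f := fun hf => hf.mono (by norm_num)
  have cA1 : CP 1 A := h.cpA.mono (by norm_num)
  have cw1 : ∀ i, CP 1 fun p => A p * w i p := fun i => cA1.mul ((h.cpw i).mono (by norm_num))
  have h3 : ∀ p, A p * (D w i f p * D w j g p - D w j f p * D w i g p)
      = A p * jac (dir i) (dir j) f g p + (A p * w j p) * jac (dir i) vx f g p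
        + (A p * w i p) * jac vx (dir j) f g p := by
    intro p
    simp only [D, jac]
    ring
  have I : ∀ {φ e e'}, CP 1 φ → CP 0 (fun p => φ p * jac e e' f g p) := fun hφ =>
    (c0 hφ).mul (cp_jac _ _ hf hg)
  have I' : ∀ {φ e e'}, CP 1 φ → CP 0 (fun p => f p * jac e e' φ g p) := fun hφ =>
    (c0 hf).mul (cp_jac _ _ hφ hg)
  simp only [h3]
  rw [integral_add ((I cA1).add (I (cw1 j))).integrableOn (I (cw1 i)).integrableOn,
    integral_add (I cA1).integrableOn (I (cw1 j)).integrableOn,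
    integral_mul_jac _ _ cA1 hf hg, integral_mul_jac _ _ (cw1 j) hf hg,
    integral_mul_jac _ _ (cw1 i) hf hg, ← neg_add, ← neg_add,
    ← integral_add (I' cA1).integrableOn (I' (cw1 j)).integrableOn,
    ← integral_add ((I' cA1).add (I' (cw1 j))).integrableOn (I' (cw1 i)).integrableOn, neg_eq_zero]
  rw [← integral_zero R3 ℝ (μ := volume.restrict cube)]
  congr 1
  funext p
  have e1 := h.div_eq_zero i p
  have e2 := h.div_eq_zero j p
  have e3 := h.curl_eq i j p
  simp only [jac]
  linear_combination f p * pd (dir j) g p * e1 - f p * pd (dir i) g p * e2 + f p * pd vx g p * e3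

end LegendreDerivatives

section EnergyEstimates

variable {L : ℝ} {A a f g : R3 → ℝ} {w : Fin 3 → R3 → ℝ} {i j : Fin 3}

/-- A periodic continuous function with zero mean for the weight `A`. -/
structure Null (A Z : R3 → ℝ) : Prop where
  cp : CP 0 Z
  integral_eq : ∫ p in cube, A p * Z p = 0

theorem Null.add {Z Z' : R3 → ℝ} (hA : CP 0 A) (hZ : Null A Z) (hZ' : Null A Z') :
    Null A fun p => Z p + Z' p := by
  refine ⟨hZ.cp.add hZ'.cp, ?_⟩
  simp only [mul_add]
  rw [integral_add (hA.mul hZ.cp).integrableOn (hA.mul hZ'.cp).integrableOn, hZ.integral_eq,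
    hZ'.integral_eq, add_zero]

theorem Null.const_mul {Z : R3 → ℝ} (hZ : Null A Z) (c : ℝ) : Null A fun p => c * Z p := by
  refine ⟨(CP.const c).mul hZ.cp, ?_⟩
  simp only [mul_left_comm _ c]
  rw [integral_const_mul, hZ.integral_eq, mul_zero]

namespace LegendreData

theorem integral_mono (h : LegendreData L A w a) (hf : CP 0 f) (hg : CP 0 g)
    (hfg : ∀ p, f p ≤ g p) : ∫ p in cube, A p * f p ≤ ∫ p in cube, A p * g p := by
  have hA : CP 0 A := h.cpA.mono (by norm_num)
  exact MeasureTheory.integral_mono (hA.mul hf).integrableOn (hA.mul hg).integrableOn fun p =>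
    mul_le_mul_of_nonneg_left (hfg p) (h.A_pos p).le

theorem integral_add_mul (h : LegendreData L A w a) (hf : CP 0 f) (hg : CP 0 g) (c d : ℝ) :
    ∫ p in cube, A p * (c * f p + d * g p)
      = c * (∫ p in cube, A p * f p) + d * ∫ p in cube, A p * g p := by
  have hA : CP 0 A := h.cpA.mono (by norm_num)
  rw [← integral_const_mul, ← integral_const_mul,
    ← integral_add ((CP.const c).mul (hA.mul hf)).integrableOn
      ((CP.const d).mul (hA.mul hg)).integrableOn]
  congr 1
  funext p
  ring

theorem integral_le_of_null (h : LegendreData L A w a) {Z : R3 → ℝ} (hf : CP 0 f) (hg : CP 0 g)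
    (hZ : Null A Z) {c : ℝ} (hle : ∀ p, f p ≤ c * g p + 1 * Z p) :
    ∫ p in cube, A p * f p ≤ c * ∫ p in cube, A p * g p := by
  have h1 := h.integral_mono hf (((CP.const c).mul hg).add ((CP.const 1).mul hZ.cp)) hle
  rw [h.integral_add_mul hg hZ.cp, hZ.integral_eq] at h1
  linarith

theorem integral_const_le (h : LegendreData L A w a) {c : ℝ} (hc : 0 ≤ c) :
    ∫ p in cube, A p * c ≤ L * c := by
  have h1 : ∫ p in cube, A p * c ≤ ∫ p in cube, L * c :=
    MeasureTheory.integral_mono ((h.cpA.mono (by norm_num)).mul (CP.const c)).integrableOn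
      (CP.const _).integrableOn fun p => mul_le_mul_of_nonneg_right (h.A_le p) hc
  simpa [Measure.real, volume_cube] using h1

theorem abs_D_le (h : LegendreData L A w a) {M : ℝ} {p : R3} (hf : ∀ e ∈ ({vx, vy, vt} : Set R3),
    |pd e f p| ≤ M) (i : Fin 3) : |D w i f p| ≤ M * (1 + L) := by
  have hM : 0 ≤ M := (abs_nonneg _).trans (hf vx (by simp))
  have h1 : |pd (dir i) f p| ≤ M := by
    fin_cases i
    · simpa [dir, pd_zero_dir] using hM
    · exact hf vy (by simp)
    · exact hf vt (by simp)
  have h2 := mul_le_mul (h.abs_w_le i p) (hf vx (by simp)) (abs_nonneg _) h.L_pos.le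
  rw [← abs_mul] at h2
  rw [D]
  linarith [abs_add_le (pd (dir i) f p) (w i p * pd vx f p)]

end LegendreData

theorem div_curl_pointwise {α a N R f₀ a₀ a₁ a₂ d₀₀ d₀₁ d₀₂ d₁₁ d₁₂ d₂₂ : ℝ} (hα : 0 < α)
    (hα1 : α ≤ 1) (ha : α ≤ a) (h₀ : |a₀| ≤ N) (h₁ : |a₁| ≤ N) (h₂ : |a₂| ≤ N)
    (h : a * d₀₀ + d₁₁ + d₂₂ = R) :
    α ^ 2 / 16 * (d₀₀ ^ 2 + d₁₁ ^ 2 + d₂₂ ^ 2 + 2 * d₀₁ ^ 2 + 2 * d₀₂ ^ 2 + 2 * d₁₂ ^ 2)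
      ≤ (3 + 2 * N ^ 2 + N ^ 2 / α) * (R ^ 2 + f₀ ^ 2)
        - 2 * (d₁₁ * d₂₂ - d₁₂ ^ 2)
        - (a * (d₀₀ * d₁₁ - d₀₁ ^ 2) + f₀ * (a₀ * d₁₁ - a₁ * d₀₁))
        - (a * (d₀₀ * d₂₂ - d₀₂ ^ 2) + f₀ * (a₀ * d₂₂ - a₂ * d₀₂)) := by
  have sq_le : ∀ {x}, |x| ≤ N → (f₀ * x) ^ 2 ≤ N ^ 2 * f₀ ^ 2 := by
    intro x hx
    have : x ^ 2 ≤ N ^ 2 := sq_le_sq' (by linarith [abs_le.mp hx]) (abs_le.mp hx).2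
    rw [mul_pow, mul_comm]
    exact mul_le_mul_of_nonneg_right this (sq_nonneg _)
  have t1 := sq_nonneg (d₁₁ / 2 - R)
  have t2 := sq_nonneg (d₂₂ / 2 - R)
  have t3 := sq_nonneg (d₁₁ / 2 - f₀ * a₀)
  have t4 := sq_nonneg (d₂₂ / 2 - f₀ * a₀)
  have young : ∀ {x d}, |x| ≤ N → 0 ≤ α / 2 * d ^ 2 + f₀ * x * d + N ^ 2 / α * f₀ ^ 2 / 2 := by
    intro x d hx
    have e1 : α / 2 * d ^ 2 + f₀ * x * d + N ^ 2 / α * f₀ ^ 2 / 2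
        = (1 / (2 * α)) * ((α * d + f₀ * x) ^ 2 + (N ^ 2 * f₀ ^ 2 - (f₀ * x) ^ 2)) := by
      field_simp
      ring
    rw [e1]
    have := sub_nonneg.mpr (sq_le hx)
    positivity
  have t5 := young (d := d₀₁) h₁
  have t6 := young (d := d₀₂) h₂
  have t7 := sq_le h₀
  have t8 : α ^ 2 * d₀₀ ^ 2 ≤ 2 * R ^ 2 + 4 * d₁₁ ^ 2 + 4 * d₂₂ ^ 2 := by
    have e1 : α ^ 2 * d₀₀ ^ 2 ≤ a ^ 2 * d₀₀ ^ 2 :=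
      mul_le_mul_of_nonneg_right (pow_le_pow_left₀ hα.le ha 2) (sq_nonneg _)
    have e2 : a * d₀₀ = R - (d₁₁ + d₂₂) := by linarith
    have e3 : a ^ 2 * d₀₀ ^ 2 = (R - (d₁₁ + d₂₂)) ^ 2 := by rw [← e2]; ring
    nlinarith [sq_nonneg (R + (d₁₁ + d₂₂)), sq_nonneg (d₁₁ - d₂₂)]
  have t9 : α ^ 2 ≤ α := by nlinarith
  have le_one : ∀ d : ℝ, α ^ 2 * d ^ 2 ≤ d ^ 2 := fun d => by
    nlinarith [mul_le_mul_of_nonneg_right (t9.trans hα1) (sq_nonneg d)]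
  have le_a : ∀ d : ℝ, α ^ 2 * d ^ 2 ≤ α * d ^ 2 := fun d =>
    mul_le_mul_of_nonneg_right t9 (sq_nonneg d)
  have le_a' : ∀ d : ℝ, α * d ^ 2 ≤ a * d ^ 2 := fun d =>
    mul_le_mul_of_nonneg_right ha (sq_nonneg d)
  have l1 := le_one d₁₁
  have l2 := le_one d₂₂
  have l3 := le_one d₁₂
  have l4 := le_a d₀₁
  have l5 := le_a d₀₂
  have l6 := le_a' d₀₁
  have l7 := le_a' d₀₂
  have hR : a * d₀₀ * (d₁₁ + d₂₂) = (R - (d₁₁ + d₂₂)) * (d₁₁ + d₂₂) := by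
    rw [show a * d₀₀ = R - (d₁₁ + d₂₂) by linarith]
  have hN : 0 ≤ N ^ 2 / α * R ^ 2 := by positivity
  have hN' : 0 ≤ N ^ 2 * R ^ 2 := by positivity
  have p1 := mul_nonneg hα.le (sq_nonneg d₀₁)
  have p2 := mul_nonneg hα.le (sq_nonneg d₀₂)
  have p3 := sq_nonneg d₁₁
  have p4 := sq_nonneg d₂₂
  have p5 := sq_nonneg d₁₂
  have p6 := sq_nonneg R
  have p7 := sq_nonneg f₀
  linarith

theorem exists_div_curl_const (L : ℝ) : ∃ C : ℝ, 0 < C ∧ ∀ A w a, LegendreData L A w a →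
    ∀ f : Fin 3 → R3 → ℝ, (∀ i, CP 1 (f i)) → (∀ i j, D w i (f j) = D w j (f i)) →
    ∀ R, CP 0 R → (∀ p, a p * D w 0 (f 0) p + D w 1 (f 1) p + D w 2 (f 2) p = R p) →
    ∫ p in cube, A p * ∑ i, ∑ j, D w i (f j) p ^ 2
      ≤ C * ∫ p in cube, A p * (R p ^ 2 + f 0 p ^ 2) := by
  by_cases hL : 1 ≤ L
  swap
  · exact ⟨1, one_pos, fun A w a h => absurd h.one_le hL⟩
  have hL0 : 0 < L := by linarith
  set N := L * (1 + L)
  refine ⟨(3 + 2 * N ^ 2 + N ^ 2 / L⁻¹) * (16 / (L⁻¹) ^ 2), by positivity,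
    fun A w a h f hf hfs R hR heq => ?_⟩
  have cA0 : CP 0 A := h.cpA.mono (by norm_num)
  have ca1 : CP 1 a := h.cpa.mono (by norm_num)
  have cw0 : ∀ i, CP 0 (w i) := fun i => (h.cpw i).mono (by norm_num)
  have cD : ∀ i {g}, CP 1 g → CP 0 (D w i g) := fun i g hg => CP.D cw0 hg i
  have da := ca1.differentiable (n := 0)
  have df := fun i => (hf i).differentiable (n := 0)
  have null : ∀ i j {g g' : R3 → ℝ}, CP 1 g → CP 1 g' →
      Null A fun p => D w i g p * D w j g' p - D w j g p * D w i g' p := fun i j g g' hg hg' =>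
    ⟨((cD i hg).mul (cD j hg')).sub ((cD j hg).mul (cD i hg')), h.integral_D_mul_D hg hg' i j⟩
  have hZ := ((null 1 2 (hf 1) (hf 2)).const_mul (-2)).add cA0
    (((null 0 1 (ca1.mul (hf 0)) (hf 1)).add cA0 (null 0 2 (ca1.mul (hf 0)) (hf 2))).const_mul (-1))
  have hG : CP 0 fun p => ∑ i, ∑ j, D w i (f j) p ^ 2 :=
    CP.sum fun i => CP.sum fun j => (cD i (hf j)).pow 2
  have hε : 0 < (L⁻¹) ^ 2 / 16 := by positivity
  refine h.integral_le_of_null hG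
    ((hR.pow 2).add (((hf 0).mono (by norm_num)).pow 2)) (hZ.const_mul (16 / (L⁻¹) ^ 2))
    fun p => ?_
  have hN : ∀ i, |D w i a p| ≤ N := fun i => h.abs_D_le (fun e he => h.abs_pd_a_le e he p) i
  have key := div_curl_pointwise (f₀ := f 0 p) (d₀₁ := D w 0 (f 1) p) (d₀₂ := D w 0 (f 2) p)
    (d₁₂ := D w 1 (f 2) p) (inv_pos.mpr hL0) (inv_le_one_of_one_le₀ hL) (h.inv_le_a p)
    (hN 0) (hN 1) (hN 2) (heq p)
  simp only [Fin.sum_univ_three, D_mul da (df 0), hfs 1 0, hfs 2 0, hfs 2 1]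
  rw [← mul_le_mul_iff_of_pos_left hε]
  have e1 : (L⁻¹) ^ 2 / 16 * (16 / (L⁻¹) ^ 2) = 1 := by
    field_simp
  calc _ = (L⁻¹) ^ 2 / 16 * (D w 0 (f 0) p ^ 2 + D w 1 (f 1) p ^ 2 + D w 2 (f 2) p ^ 2
        + 2 * D w 0 (f 1) p ^ 2 + 2 * D w 0 (f 2) p ^ 2 + 2 * D w 1 (f 2) p ^ 2) := by ring
    _ ≤ _ := key
    _ = _ := by
      generalize (L⁻¹) ^ 2 / 16 = t at e1 ⊢
      generalize 16 / (L⁻¹) ^ 2 = r at e1 ⊢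
      generalize N ^ 2 / L⁻¹ = n
      rw [one_mul, neg_one_mul, ← one_mul (_ - _), ← e1]
      ring

end EnergyEstimates

section EnergyEstimates

variable {L : ℝ} {A a f g : R3 → ℝ} {w : Fin 3 → R3 → ℝ} {i j k : Fin 3}

/-- One plus the squared norm of the gradient of `w`. -/
def gradSq (w : Fin 3 → R3 → ℝ) (p : R3) : ℝ := 1 + ∑ i, ∑ j, D w i (w j) p ^ 2

/-- The squared norm of the second derivatives of `w`. -/
def hessSq (w : Fin 3 → R3 → ℝ) (p : R3) : ℝ := ∑ k, ∑ i, ∑ j, D w i (D w j (w k)) p ^ 2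

theorem sq_D_le_gradSq (i j : Fin 3) (p : R3) : D w i (w j) p ^ 2 ≤ gradSq w p := by
  have h1 := Finset.single_le_sum (f := fun j => D w i (w j) p ^ 2) (fun j _ => sq_nonneg _)
    (Finset.mem_univ j)
  have h2 := Finset.single_le_sum (f := fun i => ∑ j, D w i (w j) p ^ 2)
    (fun i _ => Finset.sum_nonneg fun j _ => sq_nonneg _) (Finset.mem_univ i)
  simp only [gradSq]
  linarith

theorem one_le_gradSq (w : Fin 3 → R3 → ℝ) (p : R3) : 1 ≤ gradSq w p :=
  le_add_of_nonneg_right (Finset.sum_nonneg fun _ _ => Finset.sum_nonneg fun _ _ => sq_nonneg _)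

theorem sq_D_D_le_hessSq (i j k : Fin 3) (p : R3) : D w i (D w j (w k)) p ^ 2 ≤ hessSq w p := by
  have h1 := Finset.single_le_sum (f := fun j => D w i (D w j (w k)) p ^ 2)
    (fun j _ => sq_nonneg _) (Finset.mem_univ j)
  have h2 := Finset.single_le_sum (f := fun i => ∑ j, D w i (D w j (w k)) p ^ 2)
    (fun i _ => Finset.sum_nonneg fun j _ => sq_nonneg _) (Finset.mem_univ i)
  have h3 := Finset.single_le_sum (f := fun k => ∑ i, ∑ j, D w i (D w j (w k)) p ^ 2)
    (fun k _ => Finset.sum_nonneg fun _ _ => Finset.sum_nonneg fun _ _ => sq_nonneg _)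
    (Finset.mem_univ k)
  exact h1.trans (h2.trans h3)

theorem hessSq_nonneg (w : Fin 3 → R3 → ℝ) (p : R3) : 0 ≤ hessSq w p :=
  (sq_nonneg _).trans (sq_D_D_le_hessSq 0 0 0 p)

theorem abs_D_le_sqrt_gradSq (i j : Fin 3) (p : R3) : |D w i (w j) p| ≤ √(gradSq w p) :=
  Real.abs_le_sqrt (sq_D_le_gradSq i j p)

theorem one_le_sqrt_gradSq (w : Fin 3 → R3 → ℝ) (p : R3) : 1 ≤ √(gradSq w p) :=
  Real.one_le_sqrt.mpr (one_le_gradSq w p)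

namespace LegendreData

theorem cp_D_w (h : LegendreData L A w a) (i k : Fin 3) : CP 1 (D w i (w k)) :=
  CP.D (fun i => (h.cpw i).mono (by norm_num)) (h.cpw k) i

theorem cp_D_D_w (h : LegendreData L A w a) (i j k : Fin 3) : CP 0 (D w i (D w j (w k))) :=
  CP.D (fun i => (h.cpw i).mono (by norm_num)) (h.cp_D_w j k) i

theorem cp_gradSq (h : LegendreData L A w a) : CP 0 (gradSq w) :=
  (CP.const 1).add (CP.sum fun i => CP.sum fun j => ((h.cp_D_w i j).mono (by norm_num)).pow 2)

theorem cp_hessSq (h : LegendreData L A w a) : CP 0 (hessSq w) :=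
  CP.sum fun k => CP.sum fun i => CP.sum fun j => (h.cp_D_D_w i j k).pow 2

theorem integral_sum_le (h : LegendreData L A w a) {ι : Type*} [Fintype ι] {f : ι → R3 → ℝ} {c : ℝ}
    (hf : ∀ i, CP 0 (f i)) (hle : ∀ i, ∫ p in cube, A p * f i p ≤ c) :
    ∫ p in cube, A p * ∑ i, f i p ≤ Fintype.card ι * c := by
  have hA : CP 0 A := h.cpA.mono (by norm_num)
  simp only [Finset.mul_sum]
  rw [integral_finsetSum _ fun i _ => (hA.mul (hf i)).integrableOn]
  simpa using Finset.sum_le_sum fun i (_ : i ∈ Finset.univ) => hle i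

theorem abs_D_a_le (h : LegendreData L A w a) (i : Fin 3) (p : R3) :
    |D w i a p| ≤ L * (1 + L) :=
  h.abs_D_le (fun e he => h.abs_pd_a_le e he p) i

theorem abs_D_D_a_le (h : LegendreData L A w a) (i j : Fin 3) (p : R3) :
    |D w i (D w j a) p| ≤ L * (1 + L) ^ 2 + L * |D w i (w j) p| := by
  have hpd : ∀ e, Differentiable ℝ (pd e a) := fun e =>
    (CP.pd (n := 1) h.cpa e).differentiable (n := 0)
  have hw : ∀ i, Differentiable ℝ (w i) := fun i => (h.cpw i).differentiable (n := 1)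
  have e1 : D w i (D w j a) p = D w i (pd (dir j) a) p
      + (w j p * D w i (pd vx a) p + pd vx a p * D w i (w j) p) := by
    change D w i (fun p => pd (dir j) a p + w j p * pd vx a p) p = _
    rw [D_add (hpd _) ((hw j).fun_mul (hpd vx)), D_mul (hw j) (hpd vx)]
  have b0 : ∀ e' ∈ ({vx, vy, vt} : Set R3), |D w i (pd e' a) p| ≤ L * (1 + L) := fun e' he' =>
    h.abs_D_le (fun e he => h.abs_pd_pd_a_le e he e' he' p) i
  have b1 : |D w i (pd (dir j) a) p| ≤ L * (1 + L) := by
    fin_cases j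
    · have : 0 ≤ L * (1 + L) := by nlinarith [h.one_le]
      simpa [dir, pd_zero_dir, D_const] using this
    · exact b0 vy (by simp)
    · exact b0 vt (by simp)
  have b2 := mul_le_mul (h.abs_w_le j p) (b0 vx (by simp)) (abs_nonneg _) h.L_pos.le
  have b3 := mul_le_mul_of_nonneg_right (h.abs_pd_a_le vx (by simp) p) (abs_nonneg (D w i (w j) p))
  rw [← abs_mul] at b2 b3
  rw [e1]
  have t1 := abs_add_le (D w i (pd (dir j) a) p)
    (w j p * D w i (pd vx a) p + pd vx a p * D w i (w j) p)
  have t2 := abs_add_le (w j p * D w i (pd vx a) p) (pd vx a p * D w i (w j) p)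
  linarith

end LegendreData

theorem exists_integral_gradSq_bound (L : ℝ) : ∃ C : ℝ, 0 < C ∧ ∀ A w a, LegendreData L A w a →
    ∫ p in cube, A p * gradSq w p ≤ C := by
  obtain ⟨C, hC, key⟩ := exists_div_curl_const L
  by_cases hL : 1 ≤ L
  swap
  · exact ⟨1, one_pos, fun A w a h => absurd h.one_le hL⟩
  have hL0 : 0 < L := by linarith
  set M := L + L * (1 + L) * L
  refine ⟨L * 1 + C * (L * (M ^ 2 + L ^ 2)), by positivity, fun A w a h => ?_⟩
  have cw0 : ∀ i, CP 0 (w i) := fun i => (h.cpw i).mono (by norm_num)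
  have cDa : CP 0 (D w 0 a) := CP.D cw0 (h.cpa.mono (by norm_num)) 0
  have hR : CP 0 fun p => -(w 2 p + D w 0 a p * w 0 p) := ((cw0 2).add (cDa.mul (cw0 0))).neg
  have h1 := key A w a h w (fun i => (h.cpw i).mono (by norm_num)) h.D_w_symm _ hR
    fun p => by linarith [h.eqn p]
  have h2 : ∫ p in cube, A p * ((-(w 2 p + D w 0 a p * w 0 p)) ^ 2 + w 0 p ^ 2)
      ≤ ∫ p in cube, A p * (M ^ 2 + L ^ 2) := by
    refine h.integral_mono ((hR.pow 2).add ((cw0 0).pow 2)) (CP.const _) fun p => ?_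
    have b1 := mul_le_mul (h.abs_D_a_le 0 p) (h.abs_w_le 0 p) (abs_nonneg _)
      (by positivity)
    rw [← abs_mul] at b1
    refine add_le_add (sq_le_sq.mpr ?_) (sq_le_sq.mpr ?_)
    · rw [abs_neg, abs_of_nonneg (show 0 ≤ M by positivity)]
      exact (abs_add_le _ _).trans (add_le_add (h.abs_w_le 2 p) b1)
    · rw [abs_of_pos hL0]
      exact h.abs_w_le 0 p
  have h3 := h.integral_const_le (c := M ^ 2 + L ^ 2) (by positivity)
  have h4 := h.integral_const_le (c := 1) zero_le_one
  have h5 := h.integral_add_mul (CP.const 1)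
    (CP.sum fun i => CP.sum fun j => ((h.cp_D_w i j).mono (by norm_num : 0 ≤ 1)).pow 2) 1 1
  simp only [one_mul] at h5
  simp only [gradSq]
  rw [h5]
  exact add_le_add h4 (h1.trans (mul_le_mul_of_nonneg_left (h2.trans h3) hC.le))

theorem exists_integral_hessSq_bound (L : ℝ) : ∃ C : ℝ, 0 < C ∧ ∀ A w a, LegendreData L A w a →
    ∫ p in cube, A p * hessSq w p ≤ C := by
  obtain ⟨C, hC, key⟩ := exists_div_curl_const L
  obtain ⟨C', hC', key'⟩ := exists_integral_gradSq_bound L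
  by_cases hL : 1 ≤ L
  swap
  · exact ⟨1, one_pos, fun A w a h => absurd h.one_le hL⟩
  have hL0 : 0 < L := by linarith
  set N := L * (1 + L)
  have hN0 : 0 ≤ N := by positivity
  set M := N + (L * (1 + L) ^ 2 + L) * L + N + 1
  have hM : 0 ≤ M := by positivity
  refine ⟨3 * (C * ((M ^ 2 + 1) * C')), by positivity, fun A w a h => ?_⟩
  have cw0 : ∀ i, CP 0 (w i) := fun i => (h.cpw i).mono (by norm_num)
  have cw1 : ∀ i, CP 1 (w i) := fun i => (h.cpw i).mono (by norm_num)
  have cDa : ∀ i, CP 1 (D w i a) := fun i => CP.D cw1 h.cpa i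
  have cDDa : ∀ i j, CP 0 (D w i (D w j a)) := fun i j => CP.D cw0 (cDa j) i
  have cDw : ∀ i j, CP 0 (D w i (w j)) := fun i j => (h.cp_D_w i j).mono (by norm_num)
  refine h.integral_sum_le (ι := Fin 3)
    (fun k => CP.sum fun i => CP.sum fun j => (h.cp_D_D_w i j k).pow 2) fun k => ?_
  set R : R3 → ℝ := fun p => -(D w k a p * D w 0 (w 0) p + D w k (D w 0 a) p * w 0 p
    + D w 0 a p * D w k (w 0) p + D w k (w 2) p) with hRdef
  have hR : CP 0 R := (((((cDa k).mono (by norm_num)).mul (cDw 0 0)).add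
    ((cDDa k 0).mul (cw0 0))).add (((cDa 0).mono (by norm_num)).mul (cDw k 0))).add (cDw k 2) |>.neg
  have h1 := key A w a h (fun j => D w j (w k)) (fun j => h.cp_D_w j k)
    (fun i j => h.D_comm (h.cpw k) i j) R hR fun p => by
      have da : Differentiable ℝ a := h.cpa.differentiable (n := 1)
      have dw : ∀ i, Differentiable ℝ (w i) := fun i => (h.cpw i).differentiable (n := 1)
      have dDw : ∀ i j, Differentiable ℝ (D w i (w j)) := fun i j =>
        (h.cp_D_w i j).differentiable (n := 0)
      have dDa : ∀ i, Differentiable ℝ (D w i a) := fun i => (cDa i).differentiable (n := 0)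
      have e0 : D w k (fun p => a p * D w 0 (w 0) p + D w 0 a p * w 0 p + D w 1 (w 1) p
          + D w 2 (w 2) p + w 2 p) p = 0 := by
        rw [funext h.eqn, D_const]
      have t1 := da.fun_mul (dDw 0 0)
      have t2 := (dDa 0).fun_mul (dw 0)
      rw [D_add (((t1.fun_add t2).fun_add (dDw 1 1)).fun_add (dDw 2 2)) (dw 2),
        D_add ((t1.fun_add t2).fun_add (dDw 1 1)) (dDw 2 2), D_add (t1.fun_add t2) (dDw 1 1),
        D_add t1 t2, D_mul da (dDw 0 0), D_mul (dDa 0) (dw 0), h.D_comm (h.cpw 0) k 0,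
        h.D_comm (h.cpw 1) k 1, h.D_comm (h.cpw 2) k 2, h.D_w_symm k 0, h.D_w_symm k 1,
        h.D_w_symm k 2] at e0
      simp only [hRdef, h.D_w_symm k 0, h.D_w_symm k 2]
      linear_combination e0
  have h2 : ∫ p in cube, A p * (R p ^ 2 + D w 0 (w k) p ^ 2)
      ≤ ∫ p in cube, A p * ((M ^ 2 + 1) * gradSq w p) := by
    refine h.integral_mono ((hR.pow 2).add ((cDw 0 k).pow 2)) ((CP.const _).mul h.cp_gradSq)
      fun p => ?_
    have hs := one_le_sqrt_gradSq w p
    have b : ∀ i j, |D w i (w j) p| ≤ √(gradSq w p) := fun i j => abs_D_le_sqrt_gradSq i j p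
    have hss := Real.sq_sqrt (zero_le_one.trans (one_le_gradSq w p))
    have b4 := sq_D_le_gradSq (w := w) 0 k p
    generalize √(gradSq w p) = σ at hs b hss
    have b1 := mul_le_mul (h.abs_D_a_le k p) (b 0 0) (abs_nonneg _) hN0
    have b2 := mul_le_mul (h.abs_D_a_le 0 p) (b k 0) (abs_nonneg _) hN0
    have b3 : |D w k (D w 0 a) p| ≤ (L * (1 + L) ^ 2 + L) * σ := by
      have t1 := mul_le_mul_of_nonneg_left (b k 0) hL0.le
      have t2 := mul_le_mul_of_nonneg_left hs (show 0 ≤ L * (1 + L) ^ 2 by positivity)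
      linarith [h.abs_D_D_a_le k 0 p]
    have b3' := mul_le_mul b3 (h.abs_w_le 0 p) (abs_nonneg _) (by positivity)
    rw [← abs_mul] at b1 b2 b3'
    have hRp : |R p| ≤ M * σ := by
      rw [hRdef, abs_neg]
      refine (abs_add_le _ _).trans ?_
      refine (add_le_add_left ((abs_add_le _ _).trans (add_le_add_left (abs_add_le _ _) _)) _).trans
        ?_
      have e : M * σ = N * σ + (L * (1 + L) ^ 2 + L) * σ * L + N * σ + σ := by
        simp only [M]
        ring
      rw [e]
      exact add_le_add (add_le_add (add_le_add b1 b3') b2) (b k 2)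
    have : R p ^ 2 ≤ (M * σ) ^ 2 := sq_le_sq' (abs_le.mp hRp).1 (abs_le.mp hRp).2
    rw [mul_pow, hss] at this
    linarith
  refine h1.trans (mul_le_mul_of_nonneg_left (h2.trans ?_) hC.le)
  simp only [mul_left_comm _ (M ^ 2 + 1)]
  rw [integral_const_mul]
  exact mul_le_mul_of_nonneg_left (key' A w a h) (by positivity)

theorem LegendreData.integral_D_pow_four_le (h : LegendreData L A w a) (i k : Fin 3) :
    ∫ p in cube, A p * D w i (w k) p ^ 4 ≤ 9 * L ^ 2 * ∫ p in cube, A p * hessSq w p := by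
  have cq := (h.cpw k).mono (by norm_num : 1 ≤ 2)
  have cDq := h.cp_D_w i k
  have cDq0 := cDq.mono (by norm_num : 0 ≤ 1)
  have e : D w i (fun p => w k p * D w i (w k) p ^ 3) = fun p =>
      w k p * ((3 : ℕ) * D w i (w k) p ^ 2 * D w i (D w i (w k)) p) + D w i (w k) p ^ 3 * D w i (w k) p := by
    rw [D_mul (cq.differentiable (n := 0)) ((cDq.differentiable (n := 0)).fun_pow 3),
      D_pow 3 (cDq.differentiable (n := 0))]
  have hZ : Null A (D w i fun p => w k p * D w i (w k) p ^ 3) :=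
    ⟨CP.D (fun i => (h.cpw i).mono (by norm_num)) (cq.mul (cDq.pow 3)) i,
      h.integral_D (cq.mul (cDq.pow 3)) i⟩
  refine h.integral_le_of_null (cDq0.pow 4) h.cp_hessSq (hZ.const_mul 2) fun p => ?_
  rw [e]
  have h1 := sq_nonneg (D w i (w k) p ^ 2 + 3 * w k p * D w i (D w i (w k)) p)
  have h2 : w k p ^ 2 * D w i (D w i (w k)) p ^ 2 ≤ L ^ 2 * hessSq w p :=
    mul_le_mul (sq_le_sq' (abs_le.mp (h.abs_w_le k p)).1 (abs_le.mp (h.abs_w_le k p)).2)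
      (sq_D_D_le_hessSq i i k p) (sq_nonneg _) (sq_nonneg _)
  push_cast
  linarith

theorem exists_energy_bound (L : ℝ) : ∃ C : ℝ, 0 < C ∧ ∀ A w a, LegendreData L A w a →
    ∫ p in cube, A p * (gradSq w p ^ 2 + hessSq w p) ≤ C := by
  obtain ⟨C, hC, key⟩ := exists_integral_hessSq_bound L
  by_cases hL : 1 ≤ L
  swap
  · exact ⟨1, one_pos, fun A w a h => absurd h.one_le hL⟩
  have hL0 : 0 < L := by linarith
  refine ⟨10 * (L * 1 + 3 * (3 * (9 * L ^ 2 * C))) + C, by positivity, fun A w a h => ?_⟩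
  have c4 : ∀ i j, CP 0 fun p => D w i (w j) p ^ 4 := fun i j =>
    ((h.cp_D_w i j).mono (by norm_num : 0 ≤ 1)).pow 4
  have cS : CP 0 fun p => ∑ i, ∑ j, D w i (w j) p ^ 4 := CP.sum fun i => CP.sum fun j => c4 i j
  have h1 : ∫ p in cube, A p * ∑ i, ∑ j, D w i (w j) p ^ 4 ≤ 3 * (3 * (9 * L ^ 2 * C)) :=
    h.integral_sum_le (ι := Fin 3) (fun i => CP.sum fun j => c4 i j) fun i =>
      h.integral_sum_le (ι := Fin 3) (fun j => c4 i j) fun j =>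
        (h.integral_D_pow_four_le i j).trans (mul_le_mul_of_nonneg_left (key A w a h)
          (by positivity))
  have h2 : ∫ p in cube, A p * (gradSq w p ^ 2 + hessSq w p) ≤
      ∫ p in cube, A p * (1 * (10 * 1 + 10 * ∑ i, ∑ j, D w i (w j) p ^ 4) + 1 * hessSq w p) := by
    refine h.integral_mono ((h.cp_gradSq.pow 2).add h.cp_hessSq)
      (((CP.const 1).mul (((CP.const 10).mul (CP.const 1)).add ((CP.const 10).mul cS))).add
        ((CP.const 1).mul h.cp_hessSq)) fun p => ?_
    rw [one_mul, one_mul, gradSq]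
    refine add_le_add_left ?_ _
    have c1 := sq_sum_le_card_mul_sum_sq (s := (Finset.univ : Finset (Option (Fin 3 × Fin 3))))
      (f := fun o => o.elim (1 : ℝ) fun x => D w x.1 (w x.2) p ^ 2)
    simp only [Fintype.sum_option, Fintype.sum_prod_type, Option.elim, ← pow_mul] at c1
    norm_num at c1 ⊢
    linarith
  rw [h.integral_add_mul (((CP.const 10).mul (CP.const 1)).add ((CP.const 10).mul cS)) h.cp_hessSq,
    h.integral_add_mul (CP.const 1) cS] at h2
  linarith [h.integral_const_le (c := 1) zero_le_one, key A w a h]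

end EnergyEstimates

section Tame

variable {L C C' : ℝ} {A a f g : R3 → ℝ} {w : Fin 3 → R3 → ℝ} {i j k : Fin 3}

/-- The square root of the energy density for second derivatives. -/
def energyRoot (w : Fin 3 → R3 → ℝ) (p : R3) : ℝ := √(gradSq w p ^ 2 + hessSq w p)

theorem sq_energyRoot (w : Fin 3 → R3 → ℝ) (p : R3) :
    energyRoot w p ^ 2 = gradSq w p ^ 2 + hessSq w p :=
  Real.sq_sqrt (add_nonneg (sq_nonneg _) (hessSq_nonneg w p))

theorem sqrt_gradSq_mul_self_le (w : Fin 3 → R3 → ℝ) (p : R3) :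
    √(gradSq w p) * √(gradSq w p) ≤ energyRoot w p := by
  rw [Real.mul_self_sqrt (zero_le_one.trans (one_le_gradSq w p))]
  exact Real.le_sqrt_of_sq_le (le_add_of_nonneg_right (hessSq_nonneg w p))

theorem sqrt_gradSq_le_energyRoot (w : Fin 3 → R3 → ℝ) (p : R3) :
    √(gradSq w p) ≤ energyRoot w p :=
  (le_mul_of_one_le_left (Real.sqrt_nonneg _) (one_le_sqrt_gradSq w p)).trans
    (sqrt_gradSq_mul_self_le w p)

theorem one_le_energyRoot (w : Fin 3 → R3 → ℝ) (p : R3) : 1 ≤ energyRoot w p :=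
  (one_le_sqrt_gradSq w p).trans (sqrt_gradSq_le_energyRoot w p)

theorem abs_D_D_le_energyRoot (i j k : Fin 3) (p : R3) :
    |D w i (D w j (w k)) p| ≤ energyRoot w p :=
  Real.abs_le_sqrt ((sq_D_D_le_hessSq i j k p).trans (le_add_of_nonneg_left (sq_nonneg _)))

/-- A bounded function whose derivatives are controlled by those of `w`. -/
structure Tame (w : Fin 3 → R3 → ℝ) (C : ℝ) (f : R3 → ℝ) : Prop where
  cp : CP 2 f
  abs_le : ∀ p, |f p| ≤ C
  abs_D_le : ∀ i p, |D w i f p| ≤ C * √(gradSq w p)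
  abs_D_D_le : ∀ i j p, |D w i (D w j f) p| ≤ C * energyRoot w p

/-- A function that behaves like a first derivative of a tame function. -/
structure TameGrad (w : Fin 3 → R3 → ℝ) (C : ℝ) (f : R3 → ℝ) : Prop where
  cp : CP 1 f
  abs_le : ∀ p, |f p| ≤ C * √(gradSq w p)
  abs_D_le : ∀ i p, |D w i f p| ≤ C * energyRoot w p

theorem Tame.nonneg (hf : Tame w C f) : 0 ≤ C := (abs_nonneg _).trans (hf.abs_le 0)

theorem TameGrad.nonneg (hf : TameGrad w C f) : 0 ≤ C :=
  nonneg_of_mul_nonneg_left ((abs_nonneg _).trans (hf.abs_le 0))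
    (zero_lt_one.trans_le (one_le_sqrt_gradSq w 0))

theorem Tame.D (hw : ∀ i, CP 2 (w i)) (hf : Tame w C f) (i : Fin 3) : TameGrad w C (D w i f) :=
  ⟨CP.D (fun i => (hw i).mono (by norm_num)) hf.cp i, hf.abs_D_le i, fun j => hf.abs_D_D_le j i⟩

theorem TameGrad.add (hf : TameGrad w C f) (hg : TameGrad w C' g) :
    TameGrad w (C + C') fun p => f p + g p where
  cp := hf.cp.add hg.cp
  abs_le p := by
    rw [add_mul]
    exact (abs_add_le _ _).trans (add_le_add (hf.abs_le p) (hg.abs_le p))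
  abs_D_le i p := by
    rw [D_add (hf.cp.differentiable (n := 0)) (hg.cp.differentiable (n := 0)), add_mul]
    exact (abs_add_le _ _).trans (add_le_add (hf.abs_D_le i p) (hg.abs_D_le i p))

theorem Tame.mul_tameGrad (hf : Tame w C f) (hg : TameGrad w C' g) :
    TameGrad w (2 * (C * C')) fun p => f p * g p where
  cp := (hf.cp.mono (by norm_num)).mul hg.cp
  abs_le p := by
    have h1 := mul_le_mul (hf.abs_le p) (hg.abs_le p) (abs_nonneg _) hf.nonneg
    have h2 : 0 ≤ C * (C' * √(gradSq w p)) :=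
      mul_nonneg hf.nonneg (mul_nonneg hg.nonneg (Real.sqrt_nonneg _))
    rw [abs_mul]
    linarith
  abs_D_le i p := by
    have h1 := mul_le_mul (hf.abs_le p) (hg.abs_D_le i p) (abs_nonneg _) hf.nonneg
    have h2 := mul_le_mul (hg.abs_le p) (hf.abs_D_le i p) (abs_nonneg _)
      (mul_nonneg hg.nonneg (Real.sqrt_nonneg _))
    have h3 := mul_le_mul_of_nonneg_left (sqrt_gradSq_mul_self_le w p)
      (mul_nonneg hf.nonneg hg.nonneg)
    rw [← abs_mul] at h1 h2
    rw [D_mul (hf.cp.differentiable (n := 1)) (hg.cp.differentiable (n := 0))]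
    linarith [abs_add_le (f p * _root_.D w i g p) (g p * _root_.D w i f p)]

theorem Tame.of_tameGrad {M : ℝ} (cp : CP 2 f) (h : ∀ p, |f p| ≤ M)
    (hD : ∀ i, TameGrad w C (_root_.D w i f)) : Tame w (M + C) f := by
  have hM : 0 ≤ M := (abs_nonneg _).trans (h 0)
  refine ⟨cp, fun p => (h p).trans (le_add_of_nonneg_right (hD 0).nonneg), fun i p => ?_,
    fun i j p => ?_⟩
  · rw [add_mul]
    exact ((hD i).abs_le p).trans
      (le_add_of_nonneg_left (mul_nonneg hM (Real.sqrt_nonneg _)))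
  · rw [add_mul]
    exact ((hD j).abs_D_le i p).trans
      (le_add_of_nonneg_left (mul_nonneg hM (Real.sqrt_nonneg _)))

theorem Tame.add (hw : ∀ i, CP 2 (w i)) (hf : Tame w C f) (hg : Tame w C' g) :
    Tame w ((C + C') + (C + C')) fun p => f p + g p := by
  refine .of_tameGrad (hf.cp.add hg.cp)
    (fun p => (abs_add_le _ _).trans (add_le_add (hf.abs_le p) (hg.abs_le p))) fun i => ?_
  rw [D_add (hf.cp.differentiable (n := 1)) (hg.cp.differentiable (n := 1))]
  exact (hf.D hw i).add (hg.D hw i)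

theorem Tame.mul (hw : ∀ i, CP 2 (w i)) (hf : Tame w C f) (hg : Tame w C' g) :
    Tame w (C * C' + (2 * (C * C') + 2 * (C' * C))) fun p => f p * g p := by
  refine .of_tameGrad (hf.cp.mul hg.cp) (fun p => ?_) fun i => ?_
  · rw [abs_mul]
    exact mul_le_mul (hf.abs_le p) (hg.abs_le p) (abs_nonneg _) hf.nonneg
  · rw [D_mul (hf.cp.differentiable (n := 1)) (hg.cp.differentiable (n := 1))]
    exact (hf.mul_tameGrad (hg.D hw i)).add (hg.mul_tameGrad (hf.D hw i))

theorem tame_const (w : Fin 3 → R3 → ℝ) (c : ℝ) : Tame w |c| fun _ => c :=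
  ⟨.const c, fun _ => le_rfl, fun i p => by
    simpa [D_const] using mul_nonneg (abs_nonneg c) (Real.sqrt_nonneg _), fun i j p => by
    simpa [D_const] using mul_nonneg (abs_nonneg c) (zero_le_one.trans (one_le_energyRoot w p))⟩

namespace LegendreData

theorem tame_w (h : LegendreData L A w a) (k : Fin 3) : Tame w L (w k) where
  cp := h.cpw k
  abs_le := h.abs_w_le k
  abs_D_le i p := (abs_D_le_sqrt_gradSq i k p).trans
    (le_mul_of_one_le_left (Real.sqrt_nonneg _) h.one_le)
  abs_D_D_le i j p := (abs_D_D_le_energyRoot i j k p).trans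
    (le_mul_of_one_le_left (Real.sqrt_nonneg _) h.one_le)

theorem tame_a (h : LegendreData L A w a) : Tame w (L * (1 + L) ^ 2 + L) a := by
  have hL := h.L_pos
  have h0 : 0 ≤ L * (1 + L) ^ 2 := by positivity
  refine ⟨h.cpa, fun p => ?_, fun i p => ?_, fun i j p => ?_⟩
  · rw [abs_of_pos (h.a_pos p)]
    exact (h.a_le p).trans (le_add_of_nonneg_left h0)
  · refine (h.abs_D_a_le i p).trans (le_trans ?_ (le_mul_of_one_le_right (by positivity)
      (one_le_sqrt_gradSq w p)))
    nlinarith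
  · have h1 := mul_le_mul_of_nonneg_left
      ((abs_D_le_sqrt_gradSq (w := w) i j p).trans (sqrt_gradSq_le_energyRoot w p)) hL.le
    have h2 := mul_le_mul_of_nonneg_left (one_le_energyRoot w p) h0
    linarith [h.abs_D_D_a_le i j p]

theorem D_A_eq (h : LegendreData L A w a) (i : Fin 3) :
    D w i A = fun p => (-1 * A p) * (A p * D w i (w 0) p) := by
  have h1 : D w i (fun p => A p * w 0 p) = fun _ => 0 := by
    rw [funext h.mul_w_zero, D_const]
  rw [D_mul (h.cpA.differentiable (n := 1)) ((h.cpw 0).differentiable (n := 1))] at h1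
  funext p
  have h2 := congrFun h1 p
  linear_combination A p * h2 - D w i A p * h.mul_w_zero p

theorem abs_A_le (h : LegendreData L A w a) (p : R3) : |A p| ≤ L := by
  rw [abs_of_pos (h.A_pos p)]
  exact h.A_le p

theorem tame_A (h : LegendreData L A w a) : Tame w (L + (L ^ 2 + 2 * L ^ 3)) A := by
  have hL := h.L_pos
  refine .of_tameGrad h.cpA h.abs_A_le fun i => ?_
  have hw := h.cp_D_w i 0
  have cA1 : CP 1 A := h.cpA.mono (by norm_num)
  have b0 : ∀ i p, |D w i A p| ≤ L ^ 2 * √(gradSq w p) := by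
    intro i p
    have h1 := mul_le_mul (h.abs_A_le p) (mul_le_mul (h.abs_A_le p)
      (abs_D_le_sqrt_gradSq (w := w) i 0 p) (abs_nonneg _) hL.le) (by positivity) hL.le
    simp only [h.D_A_eq]
    rw [neg_one_mul, abs_mul, abs_neg, abs_mul]
    linarith
  refine ⟨CP.D (fun i => (h.cpw i).mono (by norm_num)) h.cpA i, fun p => ?_, fun j p => ?_⟩
  · refine (b0 i p).trans (mul_le_mul_of_nonneg_right ?_ (Real.sqrt_nonneg _))
    linarith [pow_pos hL 3]
  · have dA := cA1.differentiable (n := 0)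
    have dw := hw.differentiable (n := 0)
    rw [h.D_A_eq i, D_mul (dA.const_mul (-1)) (dA.fun_mul dw), D_mul (differentiable_const _) dA,
      D_mul dA dw, D_const]
    have t1 := mul_le_mul (h.abs_A_le p) (mul_le_mul (h.abs_A_le p)
      (abs_D_D_le_energyRoot (w := w) j i 0 p) (abs_nonneg _) hL.le) (by positivity) hL.le
    have t2 := mul_le_mul (h.abs_A_le p) (mul_le_mul (b0 j p)
      (abs_D_le_sqrt_gradSq (w := w) i 0 p) (abs_nonneg _)
      (mul_nonneg (sq_nonneg L) (Real.sqrt_nonneg _))) (by positivity) hL.le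
    have t3 := mul_le_mul_of_nonneg_left (sqrt_gradSq_mul_self_le w p) (pow_pos hL 3).le
    rw [← abs_mul, ← abs_mul] at t1 t2
    have e : -1 * A p * (A p * D w j (D w i (w 0)) p + D w i (w 0) p * D w j A p)
        + A p * D w i (w 0) p * (-1 * D w j A p + A p * 0)
        = -(A p * (A p * D w j (D w i (w 0)) p))
          + (-(A p * (D w j A p * D w i (w 0) p)) + -(A p * (D w j A p * D w i (w 0) p))) := by
      ring
    beta_reduce
    rw [e]
    refine (abs_add_le _ _).trans ((add_le_add_right (abs_add_le _ _) _).trans ?_)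
    simp only [abs_neg]
    linarith

theorem pd_vx_eq (h : LegendreData L A w a) (f : R3 → ℝ) :
    pd vx f = fun p => A p * D w 0 f p := by
  funext p
  simp only [D, show dir 0 = 0 from rfl, pd_zero_dir]
  linear_combination -pd vx f p * h.mul_w_zero p

theorem pd_dir_eq (h : LegendreData L A w a) (f : R3 → ℝ) (i : Fin 3) :
    pd (dir i) f = fun p => D w i f p + (-1 * (w i p * A p)) * D w 0 f p := by
  funext p
  have h1 := congrFun (h.pd_vx_eq f) p
  simp only [D] at h1 ⊢
  linear_combination -w i p * h1

theorem abs_pd_vx_le (h : LegendreData L A w a) (hf : TameGrad w C f) (p : R3) :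
    |pd vx f p| ≤ L * (C * energyRoot w p) := by
  rw [h.pd_vx_eq, abs_mul]
  exact mul_le_mul (h.abs_A_le p) (hf.abs_D_le 0 p) (abs_nonneg _) h.L_pos.le

theorem abs_pd_dir_le (h : LegendreData L A w a) (hf : TameGrad w C f) (i : Fin 3) (p : R3) :
    |pd (dir i) f p| ≤ (1 + L * L) * (C * energyRoot w p) := by
  simp only [h.pd_dir_eq]
  rw [add_mul, one_mul, neg_one_mul]
  refine (abs_add_le _ _).trans (add_le_add (hf.abs_D_le i p) ?_)
  rw [abs_mul, abs_neg, abs_mul]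
  exact mul_le_mul (mul_le_mul (h.abs_w_le i p) (h.abs_A_le p) (abs_nonneg _) h.L_pos.le)
    (hf.abs_D_le 0 p) (abs_nonneg _) (mul_nonneg h.L_pos.le h.L_pos.le)

theorem tameGrad_pd_vx (h : LegendreData L A w a) (hf : Tame w C f) :
    TameGrad w (2 * ((L + (L ^ 2 + 2 * L ^ 3)) * C)) (pd vx f) := by
  rw [h.pd_vx_eq]
  exact h.tame_A.mul_tameGrad (hf.D h.cpw 0)

theorem tameGrad_pd_dir (L C : ℝ) : ∃ C', ∀ A w a, LegendreData L A w a → ∀ f, Tame w C f → ∀ i,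
    TameGrad w C' (pd (dir i) f) := by
  have key := fun A w a (h : LegendreData L A w a) f (hf : Tame w C f) i => (hf.D h.cpw i).add
    (((tame_const w (-1)).mul h.cpw ((h.tame_w i).mul h.cpw h.tame_A)).mul_tameGrad (hf.D h.cpw 0))
  refine ⟨_, fun A w a h f hf i => (h.pd_dir_eq f i).symm ▸ key A w a h f hf i⟩

end LegendreData

/-- The Laplacian in the variables `x`, `y`, `t`. -/
def lap (f : R3 → ℝ) (p : R3) : ℝ := pd vx (pd vx f) p + pd vy (pd vy f) p + pd vt (pd vt f) p

theorem CP.lap {n : ℕ} (hf : CP (n + 2) f) : CP n (lap f) :=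
  ((CP.pd (n := n) (CP.pd (n := n + 1) hf _) _).add
    (CP.pd (n := n) (CP.pd (n := n + 1) hf _) _)).add (CP.pd (n := n) (CP.pd (n := n + 1) hf _) _)

theorem exists_abs_lap_le (L C : ℝ) : ∃ C', ∀ A w a, LegendreData L A w a → ∀ f, Tame w C f →
    ∀ p, |lap f p| ≤ C' * energyRoot w p := by
  obtain ⟨C₁, hC₁⟩ := LegendreData.tameGrad_pd_dir L C
  refine ⟨L * (2 * ((L + (L ^ 2 + 2 * L ^ 3)) * C)) + (1 + L * L) * C₁ + (1 + L * L) * C₁,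
    fun A w a h f hf p => ?_⟩
  have h1 := h.abs_pd_vx_le (h.tameGrad_pd_vx hf) p
  have h2 := h.abs_pd_dir_le (hC₁ A w a h f hf 1) 1 p
  have h3 := h.abs_pd_dir_le (hC₁ A w a h f hf 2) 2 p
  simp only [show dir 1 = vy from rfl, show dir 2 = vt from rfl] at h2 h3
  rw [lap]
  refine (abs_add_le _ _).trans ((add_le_add_left (abs_add_le _ _) _).trans ?_)
  linarith

theorem exists_tame_trace (L : ℝ) : ∃ C, ∀ A w a, LegendreData L A w a →
    Tame w C fun p => A p + (w 0 p * a p + A p * (w 1 p * w 1 p + w 2 p * w 2 p)) :=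
  ⟨_, fun _ _ _ h => h.tame_A.add h.cpw (((h.tame_w 0).mul h.cpw h.tame_a).add h.cpw
    (h.tame_A.mul h.cpw (((h.tame_w 1).mul h.cpw (h.tame_w 1)).add h.cpw
      ((h.tame_w 2).mul h.cpw (h.tame_w 2)))))⟩

/-- The Laplacian of the trace `u_xx + 1 + u_yy + u_tt + u_t + 1` is bounded in `L²`. -/
theorem exists_integral_lap_sq_bound (L : ℝ) : ∃ C, 0 < C ∧ ∀ A w a, LegendreData L A w a →
    ∫ p in cube, lap (fun p => A p + (w 0 p * a p + A p * (w 1 p * w 1 p + w 2 p * w 2 p))) p ^ 2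
      ≤ C := by
  obtain ⟨C₁, h₁⟩ := exists_tame_trace L
  obtain ⟨C₂, h₂⟩ := exists_abs_lap_le L C₁
  obtain ⟨C₃, hC₃, h₃⟩ := exists_energy_bound L
  by_cases hL : 1 ≤ L
  swap
  · exact ⟨1, one_pos, fun A w a h => absurd h.one_le hL⟩
  refine ⟨(C₂ ^ 2 * L + 1) * C₃, by positivity, fun A w a h => ?_⟩
  have hf := h₁ A w a h
  have cE : CP 0 fun p => gradSq w p ^ 2 + hessSq w p := (h.cp_gradSq.pow 2).add h.cp_hessSq
  have cA0 : CP 0 A := h.cpA.mono (by norm_num)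
  have hle : ∀ p, lap (fun p => A p + (w 0 p * a p + A p * (w 1 p * w 1 p + w 2 p * w 2 p))) p ^ 2
      ≤ C₂ ^ 2 * L * (A p * (gradSq w p ^ 2 + hessSq w p)) := by
    intro p
    have h1 := abs_le.mp (h₂ A w a h _ hf p)
    have h2 := sq_le_sq' h1.1 h1.2
    rw [mul_pow, sq_energyRoot] at h2
    have h3 : 1 ≤ L * A p := by
      have := mul_le_mul_of_nonneg_left (h.inv_le_A p) h.L_pos.le
      rwa [mul_inv_cancel₀ h.L_pos.ne'] at this
    have h4 := mul_le_mul_of_nonneg_right h3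
      (mul_nonneg (sq_nonneg C₂) (add_nonneg (sq_nonneg (gradSq w p)) (hessSq_nonneg w p)))
    linarith
  have h5 := integral_mono (μ := volume.restrict cube) ((hf.cp.lap (n := 0)).pow 2).integrableOn
    ((CP.const _).mul (cA0.mul cE)).integrableOn hle
  rw [integral_const_mul] at h5
  have h6 := mul_le_mul_of_nonneg_left (h₃ A w a h) (show 0 ≤ C₂ ^ 2 * L by positivity)
  linarith

end Tame

section LegendreTransform

variable {F u : R3 → ℝ} {K Λ : ℝ}

/-- The coefficients `1`, `-u_xy`, `-u_xt`. -/
def legCoeff (u : R3 → ℝ) (i : Fin 3) (p : R3) : ℝ :=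
  (if i = 0 then 1 else 0) - pd (dir i) (pd vx u) p

/-- The gradient components of the partial Legendre transform of `u`. -/
def legGrad (u : R3 → ℝ) (i : Fin 3) (p : R3) : ℝ := legCoeff u i p * (cA u p)⁻¹

theorem cp_legCoeff (hu : CP 4 u) (i : Fin 3) : CP 2 (legCoeff u i) :=
  (CP.const _).sub (CP.pd (n := 2) (CP.pd (n := 3) hu vx) (dir i))

theorem pd_legCoeff (hu : CP 4 u) (e : R3) (i : Fin 3) :
    pd e (legCoeff u i) = fun p => -pd e (pd (dir i) (pd vx u)) p := by
  change pd e (fun p => (if i = 0 then 1 else 0) - pd (dir i) (pd vx u) p) = _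
  rw [pd_apply_sub (differentiable_const _)
    ((CP.pd (n := 2) (CP.pd (n := 3) hu vx) (dir i)).differentiable (n := 1)), pd_apply_const]
  simp

theorem CYeq.mul_legGrad (h : CYeq F u) (hu : CP 4 u) (i : Fin 3) :
    (fun p => cA u p * legGrad u i p) = legCoeff u i := by
  funext p
  have := (h.cA_pos (hu.mono (by norm_num)) p).ne'
  rw [legGrad]
  field_simp

theorem CYeq.cp_legGrad (h : CYeq F u) (hu : CP 4 u) (i : Fin 3) : CP 2 (legGrad u i) :=
  (cp_legCoeff hu i).mul ((cp_cA (n := 2) hu).inv fun p => (h.cA_pos (hu.mono (by norm_num)) p).ne')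

theorem pd_dir_cA (hu : CP 4 u) (e : R3) :
    pd e (cA u) = pd vx (pd e (pd vx u)) := by
  have hx : ContDiff ℝ 2 (pd vx u) := ((CP.pd (n := 3) hu vx).mono (by norm_num : 2 ≤ 3)).contDiff
  rw [pd_comm (e := vx) (e' := e) hx]
  change pd e (fun p => pd vx (pd vx u) p + 1) = _
  rw [pd_apply_add ((CP.pd (n := 2) (CP.pd (n := 3) hu vx) vx).differentiable (n := 1))
    (differentiable_const _), pd_apply_const]
  simp

theorem CYeq.pd_legGrad (h : CYeq F u) (hu : CP 4 u) (e : R3) (i : Fin 3) (p : R3) :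
    pd e (legGrad u i) p = -(pd e (pd (dir i) (pd vx u)) p * (cA u p)⁻¹)
      - legCoeff u i p * pd vx (pd e (pd vx u)) p * (cA u p)⁻¹ ^ 2 := by
  have hA : ∀ p, cA u p ≠ 0 := fun p => (h.cA_pos (hu.mono (by norm_num)) p).ne'
  change pd e (fun p => legCoeff u i p * (cA u p)⁻¹) p = _
  rw [pd_apply_mul ((cp_legCoeff hu i).differentiable (n := 1))
    (((cp_cA (n := 2) hu).inv hA).differentiable (n := 1)), pd_legCoeff hu,
    pd_apply_inv ((cp_cA (n := 2) hu).differentiable (n := 1)) hA, pd_dir_cA hu]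
  field_simp
  ring

theorem CYeq.legGrad_eqn (h : CYeq F u) (hF : CP 2 F) (hu : CP 4 u) (p : R3) :
    Real.exp (F p) * D (legGrad u) 0 (legGrad u 0) p
      + D (legGrad u) 0 (fun p => Real.exp (F p)) p * legGrad u 0 p + D (legGrad u) 1 (legGrad u 1) p
      + D (legGrad u) 2 (legGrad u 2) p + legGrad u 2 p = 0 := by
  have hA : cA u p ≠ 0 := (h.cA_pos (hu.mono (by norm_num)) p).ne'
  have e1 := h.mul_eq p
  have e2 := h.pd_eq (hF.mono (by norm_num)) (hu.mono (by norm_num)) vx p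
  rw [pd_dir_cA hu, pd_vx_cB hu] at e2
  simp only [D, h.pd_legGrad hu, pd_apply_exp (hF.differentiable (n := 1)), legGrad, legCoeff,
    show dir 0 = 0 from rfl, show dir 1 = vy from rfl, show dir 2 = vt from rfl, pd_zero_dir, pd_apply_const]
  simp
  generalize cA u p = A at *
  generalize cB u p = B at *
  generalize Real.exp (F p) = E at *
  field_simp
  linear_combination pd vx (pd vx (pd vx u)) p * e1 - A * e2

theorem abs_le_of_bounds {A B E b c Λ M : ℝ} (hA : 0 < A) (hAΛ : A ≤ Λ) (hB : 0 < B) (hBΛ : B ≤ Λ)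
    (hE : M⁻¹ ≤ E) (hM : 0 < M) (h : A * B = E + b ^ 2 + c ^ 2) :
    A⁻¹ ≤ Λ * M ∧ |b| ≤ Λ ∧ |c| ≤ Λ := by
  have hΛ : 0 < Λ := hA.trans_le hAΛ
  have h1 : A * B ≤ Λ * Λ := mul_le_mul hAΛ hBΛ hB.le hΛ.le
  have hM' := inv_pos.mpr hM
  refine ⟨?_, abs_le_of_sq_le_sq (by nlinarith) hΛ.le, abs_le_of_sq_le_sq (by nlinarith) hΛ.le⟩
  refine inv_le_of_inv_le₀ (mul_pos hΛ hM) ?_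
  rw [mul_inv, inv_mul_le_iff₀ hΛ]
  nlinarith [mul_le_mul_of_nonneg_right hBΛ hA.le]

theorem C2Bound.abs_pd_exp_le (hFK : C2Bound F K) (hF : CP 2 F) {e : R3}
    (he : e ∈ ({vx, vy, vt} : Set R3)) (p : R3) :
    |pd e (fun p => Real.exp (F p)) p| ≤ Real.exp K * K := by
  have h1 : Real.exp (F p) ≤ Real.exp K := Real.exp_le_exp.mpr (abs_le.mp (hFK p).1).2
  rw [pd_apply_exp (hF.differentiable (n := 1)), abs_mul, abs_of_pos (Real.exp_pos _)]
  exact mul_le_mul h1 ((hFK p).2.1 e he) (abs_nonneg _) (Real.exp_pos _).le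

theorem C2Bound.abs_pd_pd_exp_le (hFK : C2Bound F K) (hF : CP 2 F) {e e' : R3}
    (he : e ∈ ({vx, vy, vt} : Set R3)) (he' : e' ∈ ({vx, vy, vt} : Set R3)) (p : R3) :
    |pd e (pd e' fun p => Real.exp (F p)) p| ≤ Real.exp K * K + K * (Real.exp K * K) := by
  have h1 : Real.exp (F p) ≤ Real.exp K := Real.exp_le_exp.mpr (abs_le.mp (hFK p).1).2
  have hK : 0 ≤ K := (abs_nonneg _).trans (hFK p).1
  rw [pd_apply_exp (hF.differentiable (n := 1)), pd_apply_mul (hF.exp.differentiable (n := 1))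
    ((CP.pd (n := 1) hF e').differentiable (n := 0))]
  refine (abs_add_le _ _).trans (add_le_add ?_ ?_)
  · rw [abs_mul, abs_of_pos (Real.exp_pos _)]
    exact mul_le_mul h1 ((hFK p).2.2 e he e' he') (abs_nonneg _) (Real.exp_pos _).le
  · rw [abs_mul]
    exact mul_le_mul ((hFK p).2.1 e' he') (hFK.abs_pd_exp_le hF he p) (abs_nonneg _) hK

theorem CYeq.legendreData (h : CYeq F u) (hF : CP 2 F) (hFK : C2Bound F K) (hu : CP 4 u)
    (hΛ : 1 ≤ Λ) (hAB : ∀ p, cA u p ≤ Λ ∧ cB u p ≤ Λ) :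
    LegendreData (Λ ^ 2 * Real.exp K * (1 + K) ^ 2) (cA u) (legGrad u)
      (fun p => Real.exp (F p)) := by
  have hu2 : CP 2 u := hu.mono (by norm_num)
  have hApos := h.cA_pos hu2
  have hK : 0 ≤ K := (abs_nonneg _).trans (hFK 0).1
  have hexp : 1 ≤ Real.exp K := Real.one_le_exp hK
  have hE : ∀ p, Real.exp (F p) ≤ Real.exp K := fun p =>
    Real.exp_le_exp.mpr (abs_le.mp (hFK p).1).2
  have hE' : ∀ p, (Real.exp K)⁻¹ ≤ Real.exp (F p) := fun p => by
    rw [← Real.exp_neg]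
    exact Real.exp_le_exp.mpr (abs_le.mp (hFK p).1).1
  have hbd := fun p => abs_le_of_bounds (hApos p) (hAB p).1 (h.cB_pos hu2 p) (hAB p).2 (hE' p)
    (Real.exp_pos K) (h.mul_eq p)
  set L := Λ ^ 2 * Real.exp K * (1 + K) ^ 2
  have hk : 1 ≤ (1 + K) ^ 2 := by nlinarith
  have hΛ2 : Λ ≤ Λ ^ 2 := by nlinarith
  have hΛ1 : 1 ≤ Λ ^ 2 := hΛ.trans hΛ2
  have hL1 : Λ ^ 2 * Real.exp K ≤ L := le_mul_of_one_le_right (by positivity) hk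
  have hL2 : Λ * Real.exp K ≤ L := (mul_le_mul_of_nonneg_right hΛ2 (by positivity)).trans hL1
  have hL3 : Λ ≤ L := (le_mul_of_one_le_right (by positivity) hexp).trans hL2
  have hL4 : Real.exp K ≤ L := (le_mul_of_one_le_left (by positivity) hΛ).trans hL2
  have hL5 : Real.exp K * (1 + K) ^ 2 ≤ L :=
    mul_le_mul_of_nonneg_right (le_mul_of_one_le_left (by positivity) hΛ1) (by positivity)
  have hL0 : 1 ≤ L := hΛ.trans hL3
  have hE0 := Real.exp_pos K
  refine ⟨cp_cA hu, h.cp_legGrad hu, hF.exp, fun i p => ?_, fun i j p => ?_, fun p => ?_,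
    h.legGrad_eqn hF hu, hL0, fun p => (hAB p).1.trans hL3, fun p => ?_, fun i p => ?_,
    fun p => (hE p).trans hL4, fun p => (inv_anti₀ hE0 hL4).trans (hE' p),
    fun e he p => (hFK.abs_pd_exp_le hF he p).trans (le_trans ?_ hL5),
    fun e he e' he' p => (hFK.abs_pd_pd_exp_le hF he he' p).trans (le_trans ?_ hL5)⟩
  · rw [h.mul_legGrad hu, pd_legCoeff hu, pd_dir_cA hu, add_neg_cancel]
  · rw [h.mul_legGrad hu, h.mul_legGrad hu, pd_legCoeff hu, pd_legCoeff hu,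
      pd_comm ((CP.pd (n := 3) hu vx).mono (by norm_num : 2 ≤ 3)).contDiff]
  · rw [congrFun (h.mul_legGrad hu 0) p]
    simp [legCoeff, dir, pd_zero_dir]
  · exact inv_le_of_inv_le₀ (hApos p) ((hbd p).1.trans hL2)
  · have hc : |legCoeff u i p| ≤ Λ := by
      fin_cases i
      · simpa [legCoeff, dir, pd_zero_dir] using hΛ
      · simpa [legCoeff, dir] using (hbd p).2.1
      · simpa [legCoeff, dir] using (hbd p).2.2
    rw [legGrad, abs_mul, abs_of_pos (inv_pos.mpr (hApos p))]
    refine (mul_le_mul hc (hbd p).1 (inv_pos.mpr (hApos p)).le (by positivity)).trans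
      (le_of_eq_of_le ?_ hL1)
    ring
  · nlinarith [sq_nonneg K]
  · nlinarith [sq_nonneg K]

theorem CYeq.trace_eq (h : CYeq F u) (hu : CP 4 u) :
    (fun p => cA u p + (legGrad u 0 p * Real.exp (F p) + cA u p * (legGrad u 1 p * legGrad u 1 p
      + legGrad u 2 p * legGrad u 2 p))) = fun p => cA u p + cB u p := by
  funext p
  have hA : cA u p ≠ 0 := (h.cA_pos (hu.mono (by norm_num)) p).ne'
  have e1 := h.mul_eq p
  simp [legGrad, legCoeff, dir, pd_zero_dir]
  field_simp
  linarith

theorem exists_integral_lap_trace_bound (K : ℝ) : ∃ C, 0 < C ∧ ∀ F u : R3 → ℝ, CP 2 F →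
    C2Bound F K → CP 4 u → CYeq F u →
    ∫ p in cube, lap (fun p => cA u p + cB u p) p ^ 2 ≤ C := by
  obtain ⟨Λ, hΛ, h₁⟩ := exists_ellipticity_bound K
  obtain ⟨C, hC, h₂⟩ := exists_integral_lap_sq_bound (Λ ^ 2 * Real.exp K * (1 + K) ^ 2)
  refine ⟨C, hC, fun F u hF hFK hu h => ?_⟩
  rw [← h.trace_eq hu]
  exact h₂ _ _ _ (h.legendreData hF hFK hu hΛ (h₁ F u hF hFK hu h))

end LegendreTransform

section Regularity

variable {F u f : R3 → ℝ} {k : Fin 3 → ℤ}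

theorem norm_fc_pd (hf : CP 1 f) (e : R3) (k : Fin 3 → ℤ) :
    ‖fc (pd e f) k‖ = |phase k e| * ‖fc f k‖ := by
  rw [fc_pd hf, norm_mul, norm_mul, Complex.norm_I, mul_one, Complex.norm_real, Real.norm_eq_abs]

theorem fc_lap (hf : CP 2 f) (k : Fin 3 → ℤ) :
    fc (lap f) k = ((-(4 * Real.pi ^ 2 * ∑ i, (k i : ℝ) ^ 2) : ℝ) : ℂ) * fc f k := by
  have h1 : ∀ e, CP 1 (pd e f) := fun e => CP.pd (n := 1) hf e
  have h2 : ∀ e, CP 0 (pd e (pd e f)) := fun e => CP.pd (n := 0) (h1 e) e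
  have hf1 : CP 1 f := hf.mono (by norm_num)
  change fc (fun p => pd vx (pd vx f) p + pd vy (pd vy f) p + pd vt (pd vt f) p) k = _
  rw [fc_add ((h2 vx).add (h2 vy)) (h2 vt), fc_add (h2 vx) (h2 vy), fc_pd (h1 _), fc_pd (h1 _),
    fc_pd (h1 _), fc_pd hf1, fc_pd hf1, fc_pd hf1, phase_vx, phase_vy, phase_vt, Fin.sum_univ_three]
  push_cast
  linear_combination 4 * Real.pi ^ 2 * ((k 0 : ℂ) ^ 2 + (k 1 : ℂ) ^ 2 + (k 2 : ℂ) ^ 2) * fc f k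
    * Complex.I_sq

theorem le_norm_fc_trace (hu : CP 4 u) (hk : k ≠ 0) :
    4 * Real.pi ^ 2 * (∑ i, (k i : ℝ) ^ 2) * ‖fc u k‖ ≤ ‖fc (fun p => cA u p + cB u p) k‖ := by
  have hS : 0 ≤ ∑ i, (k i : ℝ) ^ 2 := Finset.sum_nonneg fun _ _ => sq_nonneg _
  have e : (fun p => cA u p + cB u p) = fun p => lap u p + pd vt u p + 2 := by
    funext p
    simp only [cA, cB, lap]
    ring
  have h1 : CP 0 (lap u) := CP.lap (n := 0) (hu.mono (by norm_num))
  have h2 : CP 0 (pd vt u) := (CP.pd (n := 3) hu vt).mono (by norm_num)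
  rw [e, fc_add (h1.add h2) (CP.const 2), fc_add h1 h2, fc_const hk, fc_lap (hu.mono (by norm_num)),
    fc_pd (hu.mono (by norm_num)), add_zero, ← add_mul, norm_mul]
  refine mul_le_mul_of_nonneg_right (le_trans ?_ (Complex.abs_re_le_norm _)) (norm_nonneg _)
  rw [Complex.add_re, Complex.ofReal_re, Complex.re_ofReal_mul, Complex.I_re, mul_zero, add_zero,
    abs_neg]
  exact le_abs_self _

theorem sq_phase_le {e : R3} (he : e ∈ ({vx, vy, vt} : Set R3)) (k : Fin 3 → ℤ) :
    phase k e ^ 2 ≤ 4 * Real.pi ^ 2 * ∑ i, (k i : ℝ) ^ 2 := by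
  have h : ∀ i, (2 * Real.pi * k i) ^ 2 ≤ 4 * Real.pi ^ 2 * ∑ i, (k i : ℝ) ^ 2 := fun i => by
    have := Finset.single_le_sum (f := fun i => (k i : ℝ) ^ 2) (fun _ _ => sq_nonneg _)
      (Finset.mem_univ i)
    rw [mul_pow, mul_pow]
    norm_num
    exact mul_le_mul_of_nonneg_left this (by positivity)
  rcases he with rfl | rfl | rfl
  · exact phase_vx k ▸ h 0
  · exact phase_vy k ▸ h 1
  · exact phase_vt k ▸ h 2

theorem one_le_laplace_symbol (hk : k ≠ 0) : 1 ≤ 4 * Real.pi ^ 2 * ∑ i, (k i : ℝ) ^ 2 := by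
  have h1 := one_le_latNorm hk
  have h2 : 1 ≤ ∑ i, (k i : ℝ) ^ 2 := (one_le_pow₀ h1).trans (latNorm_sq_le k)
  have hpi : 1 ≤ 4 * Real.pi ^ 2 := by nlinarith [Real.pi_gt_three]
  nlinarith

theorem abs_phase_coord_le {e : R3} (he : e ∈ ({vx, vy, vt} : Set R3)) (hk : k ≠ 0) :
    |phase k e| ≤ 4 * Real.pi ^ 2 * ∑ i, (k i : ℝ) ^ 2 := by
  have h := one_le_laplace_symbol hk
  exact abs_le_of_sq_le_sq ((sq_phase_le he k).trans (by nlinarith)) (by linarith)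

theorem abs_phase_mul_abs_phase_coord_le {e e' : R3} (he : e ∈ ({vx, vy, vt} : Set R3))
    (he' : e' ∈ ({vx, vy, vt} : Set R3)) (k : Fin 3 → ℤ) :
    |phase k e| * |phase k e'| ≤ 4 * Real.pi ^ 2 * ∑ i, (k i : ℝ) ^ 2 := by
  have h1 := sq_phase_le he k
  have h2 := sq_phase_le he' k
  rw [← sq_abs] at h1 h2
  nlinarith [sq_nonneg (|phase k e| - |phase k e'|)]

/-- Fourier multipliers of order at most two applied to `u` are controlled by the Laplacian of the
trace. -/
theorem multiplier_le (hu : CP 4 u) {m : ℝ} (hm0 : 0 ≤ m)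
    (hm : k ≠ 0 → m ≤ 4 * Real.pi ^ 2 * ∑ i, (k i : ℝ) ^ 2) :
    (∑ i, (k i : ℝ) ^ 2) * (m * ‖fc u k‖) ≤ ‖fc (lap fun p => cA u p + cB u p) k‖ := by
  rcases eq_or_ne k 0 with rfl | hk
  · simp
  have hS : 0 ≤ ∑ i, (k i : ℝ) ^ 2 := Finset.sum_nonneg fun _ _ => sq_nonneg _
  have hpi : 1 ≤ 4 * Real.pi ^ 2 := by nlinarith [Real.pi_gt_three]
  rw [fc_lap ((cp_cA (n := 2) hu).add (cp_cB (n := 2) hu)), norm_mul, Complex.norm_real,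
    Real.norm_eq_abs, abs_neg, abs_of_nonneg (by positivity)]
  exact mul_le_mul (le_mul_of_one_le_left hS hpi)
    ((mul_le_mul_of_nonneg_right (hm hk) (norm_nonneg _)).trans (le_norm_fc_trace hu hk))
    (mul_nonneg hm0 (norm_nonneg _)) (by positivity)

theorem fc_pd_zero (hf : CP 1 f) (e : R3) : fc (pd e f) 0 = 0 := by
  rw [fc_zero, integral_pd hf, Complex.ofReal_zero]

end Regularity

/-- A priori `C^{2+ρ}` estimate: for every `K > 0` there are
`C₃ > 0` and `ρ ∈ (0,1)`, depending only on `K`, such that every `C⁴` solution `u`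
of the reduced Calabi–Yau equation with `‖F‖_{C²} ≤ K` and `∫ e^F = 1` satisfies
`‖u‖_{C^{2+ρ}} ≤ C₃`: all derivatives of `u` of order `≤ 2` are bounded by `C₃` and
all second derivatives are `ρ`-Hölder with constant at most `C₃`. -/
theorem stmt14 (K : ℝ) (hK : 0 < K) :
    ∃ C₃ ρ : ℝ, 0 < C₃ ∧ 0 < ρ ∧ ρ < 1 ∧
      ∀ F u : R3 → ℝ,
        ContDiff ℝ 2 F → Periodic3 F → C2Bound F K →
        (∫ p in cube, Real.exp (F p)) = 1 →
        ContDiff ℝ 4 u → Periodic3 u → ZeroMean u → CYeq F u →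
        (∀ p : R3, |u p| ≤ C₃) ∧
        (∀ e ∈ ({vx, vy, vt} : Set R3), ∀ p : R3, |pd e u p| ≤ C₃) ∧
        (∀ e ∈ ({vx, vy, vt} : Set R3), ∀ e' ∈ ({vx, vy, vt} : Set R3),
          ∀ p : R3, |pd e (pd e' u) p| ≤ C₃) ∧
        (∀ e ∈ ({vx, vy, vt} : Set R3), ∀ e' ∈ ({vx, vy, vt} : Set R3),
          ∀ q h : R3, 0 < enorm3 h → enorm3 h ≤ 1 →
            |pd e (pd e' u) (q + h) - pd e (pd e' u) q| ≤ C₃ * enorm3 h ^ ρ) := by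
  obtain ⟨C, hC, hreg⟩ := exists_holder_const
  obtain ⟨C', hC', htr⟩ := exists_integral_lap_trace_bound K
  refine ⟨C * (1 + C'), 1 / 4, by positivity, by norm_num, by norm_num, ?_⟩
  intro F u hF hFp hFK _ hu hup hu0 h
  have hCu : CP 4 u := ⟨hu, hup⟩
  have hg : CP 0 (lap fun p => cA u p + cB u p) :=
    CP.lap (n := 0) ((cp_cA (n := 2) hCu).add (cp_cB (n := 2) hCu))
  have hC₃ : C * (1 + ∫ p in cube, lap (fun p => cA u p + cB u p) p ^ 2) ≤ C * (1 + C') := by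
    have := htr F u ⟨hF, hFp⟩ hFK hCu h
    gcongr
  have hest : ∀ q : R3 → ℝ, CP 0 q → fc q 0 = 0 → ∀ m : (Fin 3 → ℤ) → ℝ, (∀ k, 0 ≤ m k) →
      (∀ k, ‖fc q k‖ = m k * ‖fc u k‖) →
      (∀ k, k ≠ 0 → m k ≤ 4 * Real.pi ^ 2 * ∑ i, (k i : ℝ) ^ 2) →
      (∀ p, |q p| ≤ C * (1 + C')) ∧
        ∀ p h, |q (p + h) - q p| ≤ C * (1 + C') * enorm3 h ^ (1 / 4 : ℝ) := by
    intro q hq hq0 m hm0 hqm hm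
    obtain ⟨h1, h2⟩ := hreg q _ hq hg hq0 fun k => hqm k ▸ multiplier_le hCu (hm0 k) (hm k)
    exact ⟨fun p => (h1 p).trans hC₃, fun p h => (h2 p h).trans
      (mul_le_mul_of_nonneg_right hC₃ (Real.rpow_nonneg (Real.sqrt_nonneg _) _))⟩
  have hCu1 : CP 1 u := hCu.mono (by norm_num)
  have hpd : ∀ e, CP 1 (pd e u) := fun e => (CP.pd (n := 3) hCu e).mono (by norm_num)
  have hsecond : ∀ e ∈ ({vx, vy, vt} : Set R3), ∀ e' ∈ ({vx, vy, vt} : Set R3),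
      (∀ p, |pd e (pd e' u) p| ≤ C * (1 + C')) ∧ ∀ p h, |pd e (pd e' u) (p + h) - pd e (pd e' u) p|
        ≤ C * (1 + C') * enorm3 h ^ (1 / 4 : ℝ) := fun e he e' he' =>
    hest _ (CP.pd (n := 0) (hpd e') e) (fc_pd_zero (hpd e') e)
      (fun k => |phase k e| * |phase k e'|) (fun k => by positivity)
      (fun k => by rw [norm_fc_pd (hpd e'), norm_fc_pd hCu1, mul_assoc])
      fun k _ => abs_phase_mul_abs_phase_coord_le he he' k
  refine ⟨?_, fun e he => ?_, fun e he e' he' => (hsecond e he e' he').1,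
    fun e he e' he' q h _ _ => (hsecond e he e' he').2 q h⟩
  · refine (hest u (hCu.mono (by norm_num)) ?_ (fun _ => 1) (fun _ => zero_le_one)
      (fun k => (one_mul _).symm) fun k hk => one_le_laplace_symbol hk).1
    rw [fc_zero, show ∫ p in cube, u p = 0 from hu0, Complex.ofReal_zero]
  · exact (hest (pd e u) ((hpd e).mono (by norm_num)) (fc_pd_zero hCu1 e) (fun k => |phase k e|)
      (fun k => abs_nonneg _) (fun k => norm_fc_pd hCu1 e k) fun k hk => abs_phase_coord_le he hk).1

end
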